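/- arXiv:1308.2027 — 2 statements merged into one kernel-verified Lean document; each statement's English description precedes it below -/
import Mathlib

section
/- Every finite simple graph G on k vertices with maximum degree Δ admits a proper vertex coloring with Δ+1 colors such that every color class has size either ⌊k/(Δ+1)⌋ or ⌈k/(Δ+1)⌉ (Hajnal–Szemerédi equitable coloring theorem). -/
section EquitableColoring

open scoped Classical
open Finset Relation

/-- The restriction of a relation to a finite set. -/
def RestrictRel {α : Type*} (r : α → α → Prop) (P : Finset α) (u v : α) : Prop :=
  u ∈ P ∧ v ∈ P ∧ r u v

theorem ReflTransGen.eq_or_exists_avoiding {α : Type*} {r : α → α → Prop} {x a : α}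
    (h : ReflTransGen r x a) :
    a = x ∨ ∃ y, y ≠ x ∧ r x y ∧ ReflTransGen (fun u v => r u v ∧ u ≠ x ∧ v ≠ x) y a := by
  induction h with
  | refl => exact Or.inl rfl
  | @tail b c hb hbc ih =>
    by_cases hc : c = x
    · exact Or.inl hc
    right
    by_cases hbx : b = x
    · subst hbx
      exact ⟨c, hc, hbc, .refl⟩
    obtain h | ⟨y, hy, hxy, hyb⟩ := ih
    · exact absurd h hbx
    · exact ⟨y, hy, hxy, hyb.tail ⟨hbc, hbx, hc⟩⟩

theorem RestrictRel.exists_first_step {α : Type*} {r : α → α → Prop} {P : Finset α} {x a : α}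
    (h : ReflTransGen (RestrictRel r P) x a) (hxa : x ≠ a) :
    ∃ y, y ∈ P ∧ y ≠ x ∧ r x y ∧ ReflTransGen (RestrictRel r (P.erase x)) y a := by
  obtain h | ⟨y, hy, hxy, hya⟩ := ReflTransGen.eq_or_exists_avoiding h
  · exact absurd h.symm hxa
  refine ⟨y, hxy.2.1, hy, hxy.2.2, ReflTransGen.mono (fun u v => ?_) _ _ hya⟩
  rintro ⟨⟨hu, hv, huv⟩, hux, hvx⟩
  exact ⟨mem_erase.2 ⟨hux, hu⟩, mem_erase.2 ⟨hvx, hv⟩, huv⟩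

theorem RestrictRel.reach_erase {α : Type*} {r : α → α → Prop} {A : Finset α} {a U W X : α}
    (hX : ReflTransGen (RestrictRel r (A.erase U)) X a)
    (hW : ¬ ReflTransGen (RestrictRel r (A.erase U)) W a) :
    ReflTransGen (RestrictRel r (A.erase W)) X a := by
  induction hX using ReflTransGen.head_induction_on with
  | refl => exact .refl
  | @head x y hxy hya ih =>
    refine ReflTransGen.head ⟨mem_erase.2 ⟨?_, mem_of_mem_erase hxy.1⟩,
      mem_erase.2 ⟨?_, mem_of_mem_erase hxy.2.1⟩, hxy.2.2⟩ ih
    · rintro rfl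
      exact hW (hya.head hxy)
    · rintro rfl
      exact hW hya

/-- If every element of `A` reaches `a`, then there are a nonempty set `T` of elements whose
deletion keeps `a` reachable from the rest of `A`, and a single `U ∉ T` through which every path
out of `T` has to leave. -/
theorem RestrictRel.exists_terminal {α : Type*} {r : α → α → Prop} {A : Finset α} {a : α}
    (ha : a ∈ A) (hreach : ∀ c ∈ A, ReflTransGen (RestrictRel r A) c a) (hA : 1 < #A) :
    ∃ U ∈ A, ∃ T ⊆ A, U ∉ T ∧ a ∉ T ∧ T.Nonempty ∧
      (∀ W ∈ T, ∀ X ∈ A, X ≠ W → ReflTransGen (RestrictRel r (A.erase W)) X a) ∧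
      ∀ W ∈ T, ∀ X ∈ A, X ∉ T → X ≠ U → ¬ r W X := by
  let T : α → Finset α := fun U =>
    (A.erase U).filter fun X => ¬ ReflTransGen (RestrictRel r (A.erase U)) X a
  have memT : ∀ U X, X ∈ T U ↔
      (X ≠ U ∧ X ∈ A) ∧ ¬ ReflTransGen (RestrictRel r (A.erase U)) X a := by
    intro U X
    simp [T]
  have hTa : (T a).Nonempty := by
    obtain ⟨X, hX, hXa⟩ := exists_mem_ne hA a
    refine ⟨X, (memT _ _).2 ⟨⟨hXa, hX⟩, fun h => ?_⟩⟩
    obtain rfl | ⟨y, hay, hy⟩ := ReflTransGen.cases_tail h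
    · exact hXa rfl
    · exact (mem_erase.1 hy.2.1).1 rfl
  obtain ⟨U, hU, hmin⟩ := exists_min_image (A.filter fun U => (T U).Nonempty) (fun U => #(T U))
    ⟨a, mem_filter.2 ⟨ha, hTa⟩⟩
  obtain ⟨hUA, hTU⟩ := mem_filter.1 hU
  refine ⟨U, hUA, T U, fun X hX => ((memT _ _).1 hX).1.2, fun h => ((memT _ _).1 h).1.1 rfl,
    fun h => ((memT _ _).1 h).2 .refl, hTU, ?_, ?_⟩
  · intro W hW X hX hXW
    by_contra hcon
    obtain ⟨⟨hWU, hWA⟩, hWr⟩ := (memT _ _).1 hW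
    have hTW : (T W).Nonempty := ⟨X, (memT _ _).2 ⟨⟨hXW, hX⟩, hcon⟩⟩
    have hle := hmin W (mem_filter.2 ⟨hWA, hTW⟩)
    refine absurd (card_lt_card (?_ : T W ⊂ T U)) (not_lt.2 hle)
    refine (ssubset_iff_of_subset fun Y hY => ?_).2
      ⟨W, hW, fun h => ((memT _ _).1 h).1.1 rfl⟩
    obtain ⟨⟨hYW, hYA⟩, hYr⟩ := (memT _ _).1 hY
    have hYU : Y ≠ U := by
      rintro rfl
      by_cases hYa : Y = a
      · subst hYa
        exact hYr .refl
      obtain ⟨y, hyA, hyY, hYy, hya⟩ := exists_first_step (hreach Y hYA) hYa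
      have hyW : y ≠ W := by
        rintro rfl
        exact hWr hya
      exact hYr ((reach_erase hya hWr).head
        ⟨mem_erase.2 ⟨hYW, hYA⟩, mem_erase.2 ⟨hyW, hyA⟩, hYy⟩)
    exact (memT _ _).2 ⟨⟨hYU, hYA⟩, fun h => hYr (reach_erase h hWr)⟩
  · intro W hW X hX hXT hXU hWX
    obtain ⟨⟨hWU, hWA⟩, hWr⟩ := (memT _ _).1 hW
    refine hXT ((memT _ _).2 ⟨⟨hXU, hX⟩, fun h => hWr (h.head ?_)⟩)
    exact ⟨mem_erase.2 ⟨hWU, hWA⟩, mem_erase.2 ⟨hXU, hX⟩, hWX⟩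

variable {V C : Type*}

/-- The vertices of `S` that `f` gives color `c`. -/
noncomputable def colorClass (S : Finset V) (f : V → C) (c : C) : Finset V :=
  S.filter fun v => f v = c

@[simp] theorem mem_colorClass {S : Finset V} {f : V → C} {c : C} {v : V} :
    v ∈ colorClass S f c ↔ v ∈ S ∧ f v = c := by
  simp [colorClass]

/-- `f` is a proper coloring of the subgraph of `G` induced on `S`. -/
def ProperOn (G : SimpleGraph V) (S : Finset V) (f : V → C) : Prop :=
  ∀ v ∈ S, ∀ w ∈ S, G.Adj v w → f v ≠ f w

/-- No neighbor of `v` in `S` has color `c`. -/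
def Movable (G : SimpleGraph V) (S : Finset V) (f : V → C) (v : V) (c : C) : Prop :=
  ∀ w ∈ S, f w = c → ¬ G.Adj v w

/-- Some vertex of color `c` can be recolored with color `d`. -/
def ClassStep (G : SimpleGraph V) (S : Finset V) (f : V → C) (c d : C) : Prop :=
  ∃ v ∈ S, f v = c ∧ Movable G S f v d

variable {G : SimpleGraph V} {S : Finset V} {f : V → C} {K : Finset C} {s : ℕ}

theorem ProperOn.update (hf : ProperOn G S f) {w : V} {c : C}
    (hw : Movable G S f w c) : ProperOn G S (Function.update f w c) := by
  intro u hu v hv huv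
  by_cases huw : u = w
  · subst huw
    rw [Function.update_self, Function.update_of_ne huv.ne']
    exact fun h => hw v hv h.symm huv
  rw [Function.update_of_ne huw]
  by_cases hvw : v = w
  · subst hvw
    rw [Function.update_self]
    exact fun h => hw u hu h huv.symm
  rw [Function.update_of_ne hvw]
  exact hf u hu v hv huv

theorem card_colorClass_update {w : V} {x y : C} (hw : w ∈ S) (hx : f w = x) (hyx : y ≠ x)
    (c : C) :
    #(colorClass S (Function.update f w y) c) + (if c = x then 1 else 0) =
      #(colorClass S f c) + if c = y then 1 else 0 := by
  by_cases hcx : c = x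
  · have h : colorClass S (Function.update f w y) c = (colorClass S f c).erase w := by
      ext v
      by_cases hv : v = w
      · subst hv; simp; grind
      · simp [hv]
    have hmem : w ∈ colorClass S f c := by simp [hw, hx, hcx]
    rw [h, if_pos hcx, if_neg (by grind), card_erase_add_one hmem, add_zero]
  rw [if_neg hcx]
  by_cases hcy : c = y
  · have h : colorClass S (Function.update f w y) c = insert w (colorClass S f c) := by
      ext v
      by_cases hv : v = w
      · subst hv; simp; grind
      · simp [hv]
    have hmem : w ∉ colorClass S f c := by simp; grind
    rw [h, if_pos hcy, card_insert_of_notMem hmem, add_zero]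
  · have h : colorClass S (Function.update f w y) c = colorClass S f c := by
      ext v
      by_cases hv : v = w
      · subst hv; simp; grind
      · simp [hv]
    rw [h, if_neg hcy]

/-- Recoloring one vertex along each step of a path of color classes from `x` to `a`. -/
theorem ProperOn.exists_shift (hf : ProperOn G S f) {a x : C} {P : Finset C} (hx : x ∈ P)
    (h : ReflTransGen (RestrictRel (ClassStep G S f) P) x a) :
    ∃ g : V → C, ProperOn G S g ∧ (∀ v, f v ∉ P → g v = f v) ∧ (∀ v, f v ∈ P → g v ∈ P) ∧
      (∀ v, g v = x → f v = x) ∧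
      ∀ c, #(colorClass S g c) + (if c = x then 1 else 0) =
        #(colorClass S f c) + if c = a then 1 else 0 := by
  induction P using Finset.strongInduction generalizing x with
  | H P ih =>
    by_cases hxa : x = a
    · subst hxa
      exact ⟨f, hf, fun _ _ => rfl, fun _ h => h, fun _ h => h, fun _ => rfl⟩
    obtain ⟨y, hyP, hyx, ⟨w, hwS, hwx, hw⟩, hya⟩ := RestrictRel.exists_first_step h hxa
    obtain ⟨g, hg, hgf, hgP, hgy, hcard⟩ :=
      ih _ (erase_ssubset hx) (mem_erase.2 ⟨hyx, hyP⟩) hya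
    have hgw : g w = x := by rw [hgf w (by simp [hwx]), hwx]
    refine ⟨Function.update g w y, hg.update fun v hv hvy => hw v hv (hgy v hvy), ?_, ?_, ?_, ?_⟩
    · intro v hv
      rw [Function.update_of_ne (by rintro rfl; exact hv (hwx ▸ hx))]
      exact hgf v fun h => hv (mem_of_mem_erase h)
    · intro v hv
      by_cases hvw : v = w
      · subst hvw
        simpa using hyP
      rw [Function.update_of_ne hvw]
      by_cases hvx : f v = x
      · rwa [hgf v (by simp [hvx])]
      · exact mem_of_mem_erase (hgP v (mem_erase.2 ⟨hvx, hv⟩))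
    · intro v hv
      by_cases hvw : v = w
      · subst hvw
        exact hwx
      rw [Function.update_of_ne hvw] at hv
      by_contra hvx
      by_cases hvP : f v ∈ P
      · exact (mem_erase.1 (hgP v (mem_erase.2 ⟨hvx, hvP⟩))).1 hv
      · exact hvx ((hgf v fun h => hvP (mem_of_mem_erase h)) ▸ hv)
    · intro c
      rw [card_colorClass_update hwS hgw hyx, hcard]

/-- The vertices of `S` whose color is not in `A`. -/
noncomputable def outside (S : Finset V) (f : V → C) (A : Finset C) : Finset V :=
  S.filter fun v => f v ∉ A

@[simp] theorem mem_outside {A : Finset C} {v : V} :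
    v ∈ outside S f A ↔ v ∈ S ∧ f v ∉ A := by
  simp [outside]

theorem card_neighbors_eq (A : Finset C) (v : V) :
    #(S.filter (G.Adj v)) = #((outside S f A).filter (G.Adj v)) +
      ∑ c ∈ A, #((colorClass S f c).filter (G.Adj v)) := by
  rw [← card_filter_add_card_filter_not (s := S.filter (G.Adj v)) (fun w => f w ∉ A)]
  congr 1
  · congr 1
    ext w
    simp
    tauto
  · rw [card_eq_sum_card_fiberwise (f := f) (t := A) (by intro w; simp)]
    refine sum_congr rfl fun c hc => ?_
    congr 1
    ext w
    simp
    grind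

theorem one_le_card_of_not_movable {v : V} {c : C} (h : ¬ Movable G S f v c) :
    1 ≤ #((colorClass S f c).filter (G.Adj v)) := by
  simp only [Movable, not_forall, not_not] at h
  obtain ⟨w, hw, hc, hvw⟩ := h
  exact card_pos.2 ⟨w, by simp [hw, hc, hvw]⟩

theorem card_add_card_outside_le {A A' : Finset C} {v : V} (hA' : A' ⊆ A)
    (h : ∀ c ∈ A', ¬ Movable G S f v c) :
    #A' + #((outside S f A).filter (G.Adj v)) ≤ #(S.filter (G.Adj v)) := by
  have h1 : #A' ≤ ∑ c ∈ A, #((colorClass S f c).filter (G.Adj v)) := by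
    rw [card_eq_sum_ones]
    exact (sum_le_sum fun c hc => one_le_card_of_not_movable (h c hc)).trans
      (sum_le_sum_of_subset hA')
  have := card_neighbors_eq (G := G) (S := S) (f := f) A v
  omega

/-- Every color of `K` is used equally often, `s` times, in a proper coloring of `S` by `K`. -/
def HasEquitable (G : SimpleGraph V) (S : Finset V) (K : Finset C) (s : ℕ) : Prop :=
  ∃ f : V → C, (∀ v ∈ S, f v ∈ K) ∧ ProperOn G S f ∧ ∀ c ∈ K, #(colorClass S f c) = s

/-- A proper coloring of `S` by `K` in which all color classes have size `s`, except for the class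
of `a`, which has size `s - 1`, and the class of `b`, which has size `s + 1`. -/
structure NearlyEquitable (G : SimpleGraph V) (S : Finset V) (K : Finset C) (s : ℕ) (f : V → C)
    (a b : C) : Prop where
  mem : ∀ v ∈ S, f v ∈ K
  proper : ProperOn G S f
  small_mem : a ∈ K
  large_mem : b ∈ K
  ne : a ≠ b
  card_small : #(colorClass S f a) + 1 = s
  card_large : #(colorClass S f b) = s + 1
  card_other : ∀ c ∈ K, c ≠ a → c ≠ b → #(colorClass S f c) = s

/-- The colors whose class can pass a vertex, along a path of classes, to the class of `a`. -/
noncomputable def accessible (G : SimpleGraph V) (S : Finset V) (f : V → C) (K : Finset C) (a : C) :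
    Finset C :=
  K.filter fun c => ReflTransGen (RestrictRel (ClassStep G S f) K) c a

theorem accessible_subset {a : C} : accessible G S f K a ⊆ K := filter_subset _ _

theorem reach_of_mem_accessible {a c : C} (hc : c ∈ accessible G S f K a) :
    ReflTransGen (RestrictRel (ClassStep G S f) (accessible G S f K a)) c a := by
  have h := (mem_filter.1 hc).2
  induction h using ReflTransGen.head_induction_on with
  | refl => exact .refl
  | @head x y hxy hya ih =>
    have hy : y ∈ accessible G S f K a := mem_filter.2 ⟨hxy.2.1, hya⟩
    exact (ih hy).head ⟨hc, hy, hxy.2.2⟩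

theorem not_movable_accessible {a c : C} {v : V} (hv : v ∈ S) (hK : f v ∈ K)
    (hfv : f v ∉ accessible G S f K a) (hc : c ∈ accessible G S f K a) :
    ¬ Movable G S f v c := by
  intro h
  obtain ⟨hcK, hca⟩ := mem_filter.1 hc
  exact hfv (mem_filter.2 ⟨hK, hca.head ⟨hK, hcK, v, hv, rfl, h⟩⟩)

theorem NearlyEquitable.card_outside {a b : C} {A : Finset C} (hf : NearlyEquitable G S K s f a b)
    (ha : a ∈ A) (hb : b ∉ A) : #(outside S f A) = #(K \ A) * s + 1 := by
  rw [card_eq_sum_card_fiberwise (f := f) (t := K \ A)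
    (by intro v; simp; exact fun hv h => ⟨hf.mem v hv, h⟩)]
  have h : ∀ c ∈ K \ A, #((outside S f A).filter fun v => f v = c) =
      s + if c = b then 1 else 0 := by
    intro c hc
    obtain ⟨hcK, hcA⟩ := mem_sdiff.1 hc
    have : (outside S f A).filter (fun v => f v = c) = colorClass S f c := by
      ext v
      simp
      grind
    rw [this]
    by_cases hcb : c = b
    · rw [if_pos hcb, hcb, hf.card_large]
    · rw [if_neg hcb, hf.card_other c hcK (by grind) hcb, add_zero]
  rw [sum_congr rfl h, sum_add_distrib, sum_const, smul_eq_mul, sum_ite_eq',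
    if_pos (mem_sdiff.2 ⟨hf.large_mem, hb⟩)]

theorem sum_neighbors_comm (B W : Finset V) (g : V → ℕ) :
    ∑ y ∈ B, ∑ w ∈ W.filter (G.Adj y), g w = ∑ w ∈ W, #(B.filter (G.Adj w)) * g w := by
  simp_rw [sum_filter]
  rw [sum_comm]
  refine sum_congr rfl fun w _ => ?_
  rw [← sum_filter, sum_const, smul_eq_mul]
  congr 2
  ext y
  simp [G.adj_comm]

/-- `z` is the only neighbor of `y` in the class of `z`. -/
def Solo (G : SimpleGraph V) (S : Finset V) (f : V → C) (z y : V) : Prop :=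
  (colorClass S f (f z)).filter (G.Adj y) = {z}

theorem Solo.adj {z y : V} (h : Solo G S f z y) : G.Adj y z := by
  have : z ∈ (colorClass S f (f z)).filter (G.Adj y) := by rw [h]; simp
  exact (mem_filter.1 this).2

theorem Solo.eq_of_adj {z y w : V} (h : Solo G S f z y) (hw : w ∈ S) (hfw : f w = f z)
    (hyw : G.Adj y w) : w = z := by
  have : w ∈ (colorClass S f (f z)).filter (G.Adj y) := by simp [hw, hfw, hyw]
  rw [h] at this
  simpa using this

theorem lt_of_solo_degree_le {B : Finset V} {W : C} {q t : ℕ} (hs : #(colorClass S f W) = s)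
    (hB : #B = q * s + 1) (hne : ∀ y ∈ B, ¬ Movable G S f y W)
    (hdeg : ∀ w ∈ colorClass S f W, #(B.filter (G.Adj w)) ≤ t + q)
    (hsolo : ∀ w ∈ colorClass S f W, ∀ y ∈ B, Solo G S f w y → #(B.filter (G.Adj w)) ≤ q) :
    q < t := by
  by_contra! htq
  let g : V → ℕ := fun w => if ∃ y ∈ B, Solo G S f w y then 2 else 1
  have h1 : ∀ y ∈ B, 2 ≤ ∑ w ∈ (colorClass S f W).filter (G.Adj y), g w := by
    intro y hy
    have hpos := one_le_card_of_not_movable (hne y hy)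
    obtain hone | htwo := hpos.eq_or_lt
    · obtain ⟨z, hz⟩ := card_eq_one.1 hone.symm
      have hzW : f z = W := by
        have : z ∈ (colorClass S f W).filter (G.Adj y) := by rw [hz]; simp
        simp at this
        exact this.1.2
      have : Solo G S f z y := by rw [Solo, hzW, hz]
      rw [hz, sum_singleton]
      simp only [g]
      rw [if_pos ⟨y, hy, this⟩]
    · refine (Nat.succ_le_of_lt htwo).trans ((card_eq_sum_ones _).trans_le (sum_le_sum fun w _ => ?_))
      simp only [g]
      split_ifs <;> omega
  have h2 : ∀ w ∈ colorClass S f W, #(B.filter (G.Adj w)) * g w ≤ 2 * q := by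
    intro w hw
    simp only [g]
    split_ifs with h
    · obtain ⟨y, hy, hwy⟩ := h
      have := hsolo w hw y hy hwy
      omega
    · have := hdeg w hw
      omega
  have h3 := card_nsmul_le_sum _ _ _ h1
  rw [sum_neighbors_comm] at h3
  have h4 := h3.trans (sum_le_card_nsmul _ _ _ h2)
  rw [hs, hB, smul_eq_mul, smul_eq_mul] at h4
  nlinarith

theorem false_of_weights {Z B : Finset V} {R : V → V → Prop} {d : V → ℕ} {q t : ℕ} (hqt : q < t)
    (hZ : #Z = t * s) (hB : #B = q * s + 1) (hdq : ∀ y ∈ B, d y + 1 ≤ q)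
    (hR : ∀ y ∈ B, t + d y + 1 ≤ #(Z.filter fun z => R z y) + q)
    (hRd : ∀ y ∈ B, ∀ z ∈ Z, R z y → #(B.filter (R z)) ≤ d y + 1) : False := by
  have hq : 0 < q := by
    obtain ⟨y, hy⟩ := card_pos.1 (show 0 < #B by omega)
    have := hdq y hy
    omega
  have hq' : (0 : ℚ) < q := by exact_mod_cast hq
  have h1 : ∀ y ∈ B, (t / q : ℚ) ≤ ∑ z ∈ Z.filter fun z => R z y, (1 / #(B.filter (R z)) : ℚ) := by
    intro y hy
    have h : ∀ z ∈ Z.filter fun z => R z y,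
        (1 / (d y + 1) : ℚ) ≤ (1 / #(B.filter (R z)) : ℚ) := by
      intro z hz
      obtain ⟨hz, hzy⟩ := mem_filter.1 hz
      have hpos : 0 < #(B.filter (R z)) := card_pos.2 ⟨y, by simp [hy, hzy]⟩
      apply one_div_le_one_div_of_le
      · exact_mod_cast hpos
      · exact_mod_cast hRd y hy z hz hzy
    refine le_trans ?_ (card_nsmul_le_sum _ _ _ h)
    rw [nsmul_eq_mul, mul_one_div, div_le_div_iff₀ hq' (by positivity)]
    have e1 : (t + d y + 1 : ℚ) ≤ #(Z.filter fun z => R z y) + q := by exact_mod_cast hR y hy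
    have e2 : (d y + 1 : ℚ) ≤ q := by exact_mod_cast hdq y hy
    have e3 : (q : ℚ) ≤ t := by exact_mod_cast hqt.le
    nlinarith [mul_nonneg (sub_nonneg.2 e3) (sub_nonneg.2 e2)]
  have h2 : ∑ y ∈ B, ∑ z ∈ Z.filter fun z => R z y, (1 / #(B.filter (R z)) : ℚ) ≤ #Z := by
    simp_rw [sum_filter]
    rw [sum_comm, card_eq_sum_ones, Nat.cast_sum]
    refine sum_le_sum fun z _ => ?_
    rw [← sum_filter, sum_const, nsmul_eq_mul, mul_one_div, Nat.cast_one]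
    exact div_self_le_one _
  have h3 := (card_nsmul_le_sum _ _ _ h1).trans h2
  rw [nsmul_eq_mul, hZ, hB, mul_div_assoc', div_le_iff₀ hq'] at h3
  have h4 : (q * s + 1) * t ≤ t * s * q := by exact_mod_cast h3
  nlinarith

theorem card_solo_add_le {A T : Finset C} {y : V} (hTA : T ⊆ A)
    (h : ∀ c ∈ A, ¬ Movable G S f y c) :
    #A + #T + #((outside S f A).filter (G.Adj y)) ≤
      #(S.filter (G.Adj y)) + #((S.filter fun z => f z ∈ T).filter fun z => Solo G S f z y) := by
  set Q := (S.filter fun z => f z ∈ T).filter fun z => Solo G S f z y with hQ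
  have hcard : #(T.filter fun c => #((colorClass S f c).filter (G.Adj y)) = 1) ≤ #Q := by
    refine (card_le_card ?_).trans (card_image_le (f := f))
    intro c hc
    obtain ⟨hcT, hc1⟩ := mem_filter.1 hc
    obtain ⟨z, hz⟩ := card_eq_one.1 hc1
    have hzm : z ∈ (colorClass S f c).filter (G.Adj y) := by rw [hz]; simp
    simp at hzm
    refine mem_image.2 ⟨z, ?_, hzm.1.2⟩
    rw [hQ, mem_filter, mem_filter, Solo, hzm.1.2]
    exact ⟨⟨hzm.1.1, hcT⟩, hz⟩
  have hsum : ∀ c ∈ A, (1 + if c ∈ T then 1 else 0) ≤ #((colorClass S f c).filter (G.Adj y)) +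
      if c ∈ T ∧ #((colorClass S f c).filter (G.Adj y)) = 1 then 1 else 0 := by
    intro c hc
    have := one_le_card_of_not_movable (h c hc)
    split_ifs <;> grind
  have := sum_le_sum hsum
  rw [sum_add_distrib, sum_add_distrib, ← card_eq_sum_ones, ← card_filter, ← card_filter,
    filter_mem_eq_inter, inter_eq_right.2 hTA] at this
  have hsub : A.filter (fun c => c ∈ T ∧ #((colorClass S f c).filter (G.Adj y)) = 1) ⊆
      T.filter fun c => #((colorClass S f c).filter (G.Adj y)) = 1 := by
    intro c
    simp
  have := card_le_card hsub
  have := card_neighbors_eq (G := G) (S := S) (f := f) A y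
  omega

/-- Color `z` by `c`, `y` by `d`, the other vertices of `B` by `g` and all others by `f`. -/
noncomputable def recolor (f g : V → C) (B : Finset V) (z y : V) (c d : C) (v : V) : C :=
  if v = z then c else if v = y then d else if v ∈ B then g v else f v

theorem hasEquitable_of_solo_movable {a b W X : C} {A : Finset C} {z y : V} {f g : V → C}
    (hf : NearlyEquitable G S K s f a b) (hAK : A ⊆ K) (hbA : b ∉ A) (hW : W ∈ A)
    (haW : a ≠ W) (hX : X ∈ A) (hXW : X ≠ W)
    (hreach : ReflTransGen (RestrictRel (ClassStep G S f) (A.erase W)) X a)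
    (hz : z ∈ S) (hzW : f z = W) (hzX : Movable G S f z X) (hy : y ∈ S) (hyA : f y ∉ A)
    (hzy : ∀ w ∈ S, f w = W → G.Adj y w → w = z)
    (hgK : ∀ v ∈ (outside S f A).erase y, g v ∈ K \ A)
    (hg : ProperOn G ((outside S f A).erase y) g)
    (hgs : ∀ c ∈ K \ A, #(colorClass ((outside S f A).erase y) g c) = s) :
    HasEquitable G S K s := by
  obtain ⟨f₁, hf₁, hout, hin, hfX, hcard⟩ :=
    hf.proper.exists_shift (mem_erase.2 ⟨hXW, hX⟩) hreach
  have hyz : y ≠ z := by rintro rfl; exact hyA (hzW ▸ hW)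
  have hfW : ∀ v, f v ∈ A → (f₁ v = W ↔ f v = W) := by
    intro v hv
    by_cases hvW : f v = W
    · rw [hout v (by simp [hvW])]
    · have := (mem_erase.1 (hin v (mem_erase.2 ⟨hvW, hv⟩))).1
      tauto
  have hfA : ∀ v, f₁ v ∈ A ↔ f v ∈ A := by
    intro v
    by_cases hv : f v ∈ A.erase W
    · exact ⟨fun _ => mem_of_mem_erase hv, fun _ => mem_of_mem_erase (hin v hv)⟩
    · rw [hout v hv]
  set h := recolor f₁ g (outside S f A) z y X W with hh
  have hhz : h z = X := by simp [hh, recolor]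
  have hhy : h y = W := by simp [hh, recolor, hyz]
  have hhg : ∀ v ∈ S, v ≠ y → f v ∉ A → h v = g v := by
    intro v hv hvy hvA
    have : v ≠ z := by rintro rfl; exact hvA (hzW ▸ hW)
    simp [hh, recolor, this, hvy, hv, hvA]
  have hhf : ∀ v, v ≠ z → f v ∈ A → h v = f₁ v := by
    intro v hvz hvA
    have : v ≠ y := by rintro rfl; exact hyA hvA
    simp [hh, recolor, this, hvz, hvA]
  have hgm : ∀ v ∈ S, v ≠ y → f v ∉ A → g v ∈ K \ A := fun v hv hvy hvA =>
    hgK v (by simp [hv, hvy, hvA])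
  have hcases : ∀ v ∈ S, v = z ∨ v = y ∨ (v ≠ y ∧ f v ∉ A ∧ h v = g v ∧ g v ∈ K ∧ g v ∉ A) ∨
      (v ≠ z ∧ f v ∈ A ∧ h v = f₁ v) := by
    intro v hv
    by_cases hvz : v = z
    · exact Or.inl hvz
    by_cases hvy : v = y
    · exact Or.inr (Or.inl hvy)
    by_cases hvA : f v ∈ A
    · exact Or.inr (Or.inr (Or.inr ⟨hvz, hvA, hhf v hvz hvA⟩))
    · have := mem_sdiff.1 (hgm v hv hvy hvA)
      exact Or.inr (Or.inr (Or.inl ⟨hvy, hvA, hhg v hv hvy hvA, this.1, this.2⟩))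
  have hzy' : ∀ v ∈ S, G.Adj z v → h z ≠ h v := by
    intro v hv hzv heq
    rw [hhz] at heq
    obtain rfl | rfl | ⟨-, -, h1, -, h2⟩ | ⟨h0, h1, h2⟩ := hcases v hv
    · exact hzv.ne rfl
    · exact hXW (heq.trans hhy)
    · exact h2 (by rw [← h1, ← heq]; exact hX)
    · exact hzX v hv (hfX v (by rw [← h2, ← heq])) hzv
  have hyv : ∀ v ∈ S, G.Adj y v → h y ≠ h v := by
    intro v hv hyv heq
    obtain rfl | rfl | ⟨-, -, h1, -, h2⟩ | ⟨h0, h1, h2⟩ := hcases v hv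
    · exact hzy' y hy hyv.symm heq.symm
    · exact hyv.ne rfl
    · exact h2 (by rw [← h1, ← heq, hhy]; exact hW)
    · exact h0 (hzy v hv ((hfW v h1).1 (by rw [← h2, ← heq, hhy])) hyv)
  refine ⟨h, ?_, ?_, ?_⟩
  · intro v hv
    obtain rfl | rfl | ⟨-, -, h1, h2, -⟩ | ⟨h0, h1, h2⟩ := hcases v hv
    · rw [hhz]; exact hAK hX
    · rw [hhy]; exact hAK hW
    · rwa [h1]
    · rw [h2]; exact hAK ((hfA v).2 h1)
  · intro v hv w hw hvw heq
    obtain rfl | rfl | ⟨hvy, hvA, h1, -, h2⟩ | ⟨h0, h1, h2⟩ := hcases v hv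
    · exact hzy' w hw hvw heq
    · exact hyv w hw hvw heq
    all_goals
      obtain rfl | rfl | ⟨hwy, hwA, k1, -, k2⟩ | ⟨k0, k1, k2⟩ := hcases w hw
      · exact hzy' v hv hvw.symm heq.symm
      · exact hyv v hv hvw.symm heq.symm
    · exact hg v (by simp [hvy, hvA, hv]) w (by simp [hwy, hwA, hw]) hvw (by rw [← h1, ← k1, heq])
    · exact h2 (by rw [← h1, heq, k2]; exact (hfA w).2 k1)
    · exact k2 (by rw [← k1, ← heq, h2]; exact (hfA v).2 h1)
    · exact hf₁ v hv w hw hvw (by rw [← h2, ← k2, heq])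
  · intro c hc
    by_cases hcA : c ∈ A
    · have hcf : c ≠ W → c ≠ a → #(colorClass S f c) = s := fun _ hca =>
        hf.card_other c hc hca (by rintro rfl; exact hbA hcA)
      by_cases hcW : c = W
      · have : colorClass S h c = insert y ((colorClass S f W).erase z) := by
          ext v
          simp only [mem_colorClass, mem_insert, mem_erase]
          by_cases hvS : v ∈ S
          · obtain rfl | rfl | ⟨h0, h1, h2, h3, h4⟩ | ⟨h0, h1, h2⟩ := hcases v hvS
            · grind
            · grind
            · grind
            · have := hfW v h1
              grind
          · grind
        have hzm : z ∈ colorClass S f W := by simp [hz, hzW]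
        rw [this, card_insert_of_notMem (by simp; grind), card_erase_add_one hzm]
        exact hf.card_other W (hAK hW) haW.symm (by rintro rfl; exact hbA hW)
      have hcc := hcard c
      have hcs : #(colorClass S f c) + (if c = a then 1 else 0) = s := by
        by_cases hca : c = a
        · rw [if_pos hca, hca, hf.card_small]
        · rw [if_neg hca, hcf hcW hca, add_zero]
      rw [hcs] at hcc
      have hfc : ∀ v, f₁ v = c → f v ∈ A := fun v hv => (hfA v).1 (hv ▸ hcA)
      by_cases hcX : c = X
      · have : colorClass S h c = insert z (colorClass S f₁ c) := by
          ext v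
          simp only [mem_colorClass, mem_insert]
          by_cases hvS : v ∈ S
          · have := hfc v
            obtain rfl | rfl | ⟨h0, h1, h2, h3, h4⟩ | ⟨h0, h1, h2⟩ := hcases v hvS <;> grind
          · grind
        have hzn : z ∉ colorClass S f₁ c := by
          have := hfX z
          simp
          grind
        rw [this, card_insert_of_notMem hzn, ← hcc, if_pos hcX]
      · have : colorClass S h c = colorClass S f₁ c := by
          ext v
          simp only [mem_colorClass]
          by_cases hvS : v ∈ S
          · have := hfc v
            have := hfW v
            obtain rfl | rfl | ⟨h0, h1, h2, h3, h4⟩ | ⟨h0, h1, h2⟩ := hcases v hvS <;> grind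
          · grind
        rw [this, ← hcc, if_neg hcX, add_zero]
    · have : colorClass S h c = colorClass ((outside S f A).erase y) g c := by
        ext v
        simp only [mem_colorClass, mem_erase, mem_outside]
        by_cases hvS : v ∈ S
        · have := hfA v
          obtain rfl | rfl | ⟨h0, h1, h2, h3, h4⟩ | ⟨h0, h1, h2⟩ := hcases v hvS <;> grind
        · grind
      rw [this, hgs c (mem_sdiff.2 ⟨hc, hcA⟩)]

theorem nearlyEquitable_recolor {a b W Y : C} {A : Finset C} {z y : V} {f g : V → C}
    (hf : NearlyEquitable G S K s f a b) (hAK : A ⊆ K) (hbA : b ∉ A) (hW : W ∈ A)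
    (haA : a ∈ A) (haW : a ≠ W)
    (hz : z ∈ S) (hzW : f z = W) (hy : y ∈ S) (hyA : f y ∉ A)
    (hzy : ∀ w ∈ S, f w = W → G.Adj y w → w = z)
    (hgK : ∀ v ∈ (outside S f A).erase y, g v ∈ K \ A)
    (hg : ProperOn G ((outside S f A).erase y) g)
    (hgs : ∀ c ∈ K \ A, #(colorClass ((outside S f A).erase y) g c) = s)
    (hY : Y ∈ K \ A) (hzY : Movable G ((outside S f A).erase y) g z Y) :
    NearlyEquitable G S K s (recolor f g (outside S f A) z y Y W) a Y := by
  obtain ⟨hYK, hYA⟩ := mem_sdiff.1 hY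
  have hyz : y ≠ z := by rintro rfl; exact hyA (hzW ▸ hW)
  set h := recolor f g (outside S f A) z y Y W with hh
  have hhz : h z = Y := by simp [hh, recolor]
  have hhy : h y = W := by simp [hh, recolor, hyz]
  have hcases : ∀ v ∈ S, v = z ∨ v = y ∨ (v ≠ y ∧ f v ∉ A ∧ h v = g v ∧ g v ∈ K ∧ g v ∉ A) ∨
      (v ≠ z ∧ f v ∈ A ∧ h v = f v) := by
    intro v hv
    by_cases hvz : v = z
    · exact Or.inl hvz
    by_cases hvy : v = y
    · exact Or.inr (Or.inl hvy)
    by_cases hvA : f v ∈ A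
    · exact Or.inr (Or.inr (Or.inr ⟨hvz, hvA, by simp [hh, recolor, hvy, hvz, hvA]⟩))
    · have := mem_sdiff.1 (hgK v (by simp [hv, hvy, hvA]))
      exact Or.inr (Or.inr (Or.inl
        ⟨hvy, hvA, by simp [hh, recolor, hvy, hvz, hvA, hv], this.1, this.2⟩))
  have hzy' : ∀ v ∈ S, G.Adj z v → h z ≠ h v := by
    intro v hv hzv heq
    rw [hhz] at heq
    obtain rfl | rfl | ⟨h0, h3, h1, -, h2⟩ | ⟨h0, h1, h2⟩ := hcases v hv
    · exact hzv.ne rfl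
    · exact hYA (by rw [heq, hhy]; exact hW)
    · exact hzY v (by simp [hv, h0, h3]) (by rw [← h1, heq]) hzv
    · exact hYA (by rwa [heq, h2])
  have hyv : ∀ v ∈ S, G.Adj y v → h y ≠ h v := by
    intro v hv hyv heq
    obtain rfl | rfl | ⟨-, -, h1, -, h2⟩ | ⟨h0, h1, h2⟩ := hcases v hv
    · exact hzy' y hy hyv.symm heq.symm
    · exact hyv.ne rfl
    · exact h2 (by rw [← h1, ← heq, hhy]; exact hW)
    · exact h0 (hzy v hv (by rw [← h2, ← heq, hhy]) hyv)
  have hclass : ∀ c, c ≠ W → c ∈ A → colorClass S h c = colorClass S f c := by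
    intro c hcW hcA
    ext v
    simp only [mem_colorClass]
    by_cases hvS : v ∈ S
    · obtain rfl | rfl | ⟨h0, h1, h2, h3, h4⟩ | ⟨h0, h1, h2⟩ := hcases v hvS <;> grind
    · grind
  have hclass' : ∀ c, c ≠ Y → c ∉ A →
      colorClass S h c = colorClass ((outside S f A).erase y) g c := by
    intro c hcY hcA
    ext v
    simp only [mem_colorClass, mem_erase, mem_outside]
    by_cases hvS : v ∈ S
    · obtain rfl | rfl | ⟨h0, h1, h2, h3, h4⟩ | ⟨h0, h1, h2⟩ := hcases v hvS <;> grind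
    · grind
  refine ⟨?_, ?_, hf.small_mem, hYK, ?_, ?_, ?_, ?_⟩
  · intro v hv
    obtain rfl | rfl | ⟨-, -, h1, h2, -⟩ | ⟨h0, h1, h2⟩ := hcases v hv
    · rwa [hhz]
    · rw [hhy]; exact hAK hW
    · rwa [h1]
    · rw [h2]; exact hAK h1
  · intro v hv w hw hvw heq
    obtain rfl | rfl | ⟨hvy, hvA, h1, -, h2⟩ | ⟨h0, h1, h2⟩ := hcases v hv
    · exact hzy' w hw hvw heq
    · exact hyv w hw hvw heq
    all_goals
      obtain rfl | rfl | ⟨hwy, hwA, k1, -, k2⟩ | ⟨k0, k1, k2⟩ := hcases w hw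
      · exact hzy' v hv hvw.symm heq.symm
      · exact hyv v hv hvw.symm heq.symm
    · exact hg v (by simp [hvy, hvA, hv]) w (by simp [hwy, hwA, hw]) hvw (by rw [← h1, ← k1, heq])
    · exact h2 (by rwa [← h1, heq, k2])
    · exact k2 (by rwa [← k1, ← heq, h2])
    · exact hf.proper v hv w hw hvw (by rw [← h2, ← k2, heq])
  · rintro rfl
    exact hYA haA
  · rw [hclass a haW haA, hf.card_small]
  · have : colorClass S h Y = insert z (colorClass ((outside S f A).erase y) g Y) := by
      ext v
      simp only [mem_colorClass, mem_insert, mem_erase, mem_outside]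
      by_cases hvS : v ∈ S
      · obtain rfl | rfl | ⟨h0, h1, h2, h3, h4⟩ | ⟨h0, h1, h2⟩ := hcases v hvS <;> grind
      · grind
    rw [this, card_insert_of_notMem (by simp; grind), hgs Y hY]
  · intro c hc hca hcY
    by_cases hcA : c ∈ A
    · by_cases hcW : c = W
      · have : colorClass S h c = insert y ((colorClass S f W).erase z) := by
          ext v
          simp only [mem_colorClass, mem_insert, mem_erase]
          by_cases hvS : v ∈ S
          · obtain rfl | rfl | ⟨h0, h1, h2, h3, h4⟩ | ⟨h0, h1, h2⟩ := hcases v hvS <;> grind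
          · grind
        have hzm : z ∈ colorClass S f W := by simp [hz, hzW]
        rw [this, card_insert_of_notMem (by simp; grind), card_erase_add_one hzm]
        exact hf.card_other W (hAK hW) haW.symm (by rintro rfl; exact hbA hW)
      · rw [hclass c hcW hcA]
        exact hf.card_other c hc hca (by rintro rfl; exact hbA hcA)
    · rw [hclass' c hcY hcA, hgs c (mem_sdiff.2 ⟨hc, hcA⟩)]

theorem NearlyEquitable.hasEquitable_of_accessible {a b : C} (hf : NearlyEquitable G S K s f a b)
    (hb : b ∈ accessible G S f K a) : HasEquitable G S K s := by
  obtain ⟨g, hg, -, hgK, -, hcard⟩ :=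
    hf.proper.exists_shift hf.large_mem (mem_filter.1 hb).2
  refine ⟨g, fun v hv => hgK v (hf.mem v hv), hg, fun c hc => ?_⟩
  have h := hcard c
  have hab := hf.ne
  have ha := hf.card_small
  have hb := hf.card_large
  by_cases hca : c = a
  · subst hca
    simp [hab] at h
    omega
  by_cases hcb : c = b
  · subst hcb
    simp [hca] at h
    omega
  · have := hf.card_other c hc hca hcb
    simp [hca, hcb] at h
    omega

theorem NearlyEquitable.one_lt_card_accessible {a b : C} (hf : NearlyEquitable G S K s f a b)
    (hdeg : ∀ v ∈ S, #(S.filter (G.Adj v)) < #K) (hb : b ∉ accessible G S f K a) :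
    1 < #(accessible G S f K a) := by
  have haA : a ∈ accessible G S f K a := mem_filter.2 ⟨hf.small_mem, .refl⟩
  have hB := hf.card_outside haA hb
  have hAK : #(K \ accessible G S f K a) + #(accessible G S f K a) = #K :=
    card_sdiff_add_card_eq_card accessible_subset
  set A := accessible G S f K a with hA
  by_contra! hA1
  have h1 : ∀ y ∈ outside S f A, 1 ≤ ∑ w ∈ (colorClass S f a).filter (G.Adj y), 1 := by
    intro y hy
    obtain ⟨hyS, hyA⟩ := mem_outside.1 hy
    rw [← card_eq_sum_ones]
    exact one_le_card_of_not_movable (not_movable_accessible hyS (hf.mem y hyS) hyA haA)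
  have h2 := card_nsmul_le_sum _ _ _ h1
  rw [sum_neighbors_comm] at h2
  have h3 : ∀ w ∈ colorClass S f a, #((outside S f A).filter (G.Adj w)) * 1 ≤ #(K \ A) := by
    intro w hw
    have h4 := hdeg w (mem_colorClass.1 hw).1
    have h5 : #((outside S f A).filter (G.Adj w)) ≤ #(S.filter (G.Adj w)) :=
      card_le_card (filter_subset_filter _ (filter_subset _ _))
    omega
  have h4 := h2.trans (sum_le_card_nsmul _ _ _ h3)
  rw [hB, smul_eq_mul, smul_eq_mul, ← hf.card_small] at h4
  nlinarith

theorem reach_of_color_iff {f g : V → C} {P : Finset C} (hPK : P ⊆ K)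
    (hfg : ∀ v ∈ S, ∀ c ∈ P, g v = c ↔ f v = c) {X a : C}
    (h : ReflTransGen (RestrictRel (ClassStep G S f) P) X a) :
    ReflTransGen (RestrictRel (ClassStep G S g) K) X a := by
  refine ReflTransGen.mono (fun u v => ?_) _ _ h
  rintro ⟨hu, hv, w, hw, hwu, hwv⟩
  exact ⟨hPK hu, hPK hv, w, hw, (hfg w hw u hu).2 hwu,
    fun x hx hxv => hwv x hx ((hfg x hx v hv).1 hxv)⟩

theorem card_sdiff_accessible_recolor_lt {a W Y : C} {z y x : V} {f g : V → C}
    (hW : W ∈ accessible G S f K a) (haW : a ≠ W)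
    (hreach : ∀ X ∈ accessible G S f K a, X ≠ W →
      ReflTransGen (RestrictRel (ClassStep G S f) ((accessible G S f K a).erase W)) X a)
    (hzW : f z = W) (hzX : ∀ X ∈ accessible G S f K a, X ≠ W → ¬ Movable G S f z X)
    (hyA : f y ∉ accessible G S f K a)
    (hgK : ∀ v ∈ (outside S f (accessible G S f K a)).erase y, g v ∈ K \ accessible G S f K a)
    (hY : Y ∈ K \ accessible G S f K a)
    (hx : x ∈ S) (hxA : f x ∉ accessible G S f K a) (hxy : x ≠ y) (hyx : ¬ G.Adj x y)
    (hxz : ∀ w ∈ S, f w = W → G.Adj x w → w = z) :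
    #(K \ accessible G S (recolor f g (outside S f (accessible G S f K a)) z y Y W) K a) <
      #(K \ accessible G S f K a) := by
  have hWr := reach_of_mem_accessible hW
  have hAK : accessible G S f K a ⊆ K := accessible_subset
  set A := accessible G S f K a with hA
  obtain ⟨hYK, hYA⟩ := mem_sdiff.1 hY
  have hyz : y ≠ z := by rintro rfl; exact hyA (hzW ▸ hW)
  set h := recolor f g (outside S f A) z y Y W with hh
  have hcases : ∀ v ∈ S, (v = z ∧ h v = Y) ∨ (v = y ∧ h v = W) ∨
      (v ≠ y ∧ f v ∉ A ∧ h v = g v ∧ g v ∈ K ∧ g v ∉ A) ∨ (v ≠ z ∧ f v ∈ A ∧ h v = f v) := by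
    intro v hv
    by_cases hvz : v = z
    · exact Or.inl ⟨hvz, by simp [hh, recolor, hvz]⟩
    by_cases hvy : v = y
    · exact Or.inr (Or.inl ⟨hvy, by simp [hh, recolor, hvy, hyz]⟩)
    by_cases hvA : f v ∈ A
    · exact Or.inr (Or.inr (Or.inr ⟨hvz, hvA, by simp [hh, recolor, hvy, hvz, hvA]⟩))
    · have := mem_sdiff.1 (hgK v (by simp [hv, hvy, hvA]))
      exact Or.inr (Or.inr (Or.inl
        ⟨hvy, hvA, by simp [hh, recolor, hvy, hvz, hvA, hv], this.1, this.2⟩))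
  have hiff : ∀ v ∈ S, ∀ c ∈ A.erase W, h v = c ↔ f v = c := by
    intro v hv c hc
    obtain ⟨hcW, hcA⟩ := mem_erase.1 hc
    obtain ⟨rfl, h0⟩ | ⟨rfl, h0⟩ | ⟨h0, h1, h2, h3, h4⟩ | ⟨h0, h1, h2⟩ := hcases v hv <;> grind
  have hreach' : ∀ X ∈ A, X ≠ W → ReflTransGen (RestrictRel (ClassStep G S h) K) X a :=
    fun X hX hXW => reach_of_color_iff ((erase_subset _ _).trans hAK) hiff (hreach X hX hXW)
  have hWreach : ReflTransGen (RestrictRel (ClassStep G S h) K) W a := by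
    obtain ⟨X, hX, hXW, ⟨w, hw, hwW, hwX⟩, -⟩ := RestrictRel.exists_first_step hWr haW.symm
    refine (hreach' X hX hXW).head ⟨hAK hW, hAK hX, w, hw, ?_, fun v hv hvX => ?_⟩
    · have hwz : w ≠ z := by
        rintro rfl
        exact hzX X hX hXW hwX
      obtain ⟨rfl, h0⟩ | ⟨rfl, h0⟩ | ⟨h0, h1, h2, h3, h4⟩ | ⟨h0, h1, h2⟩ := hcases w hw <;> grind
    · exact hwX v hv ((hiff v hv X (mem_erase.2 ⟨hXW, hX⟩)).1 hvX)
  have hxg : h x = g x ∧ g x ∈ K ∧ g x ∉ A := by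
    obtain ⟨rfl, h0⟩ | ⟨rfl, h0⟩ | ⟨h0, h1, h2, h3, h4⟩ | ⟨h0, h1, h2⟩ := hcases x hx <;> grind
  obtain ⟨hxg, hgxK, hgxA⟩ := hxg
  have hxreach : ReflTransGen (RestrictRel (ClassStep G S h) K) (g x) a := by
    refine hWreach.head ⟨hgxK, hAK hW, x, hx, hxg, fun v hv hvW hxv => ?_⟩
    have := hxz v hv
    obtain ⟨rfl, h0⟩ | ⟨rfl, h0⟩ | ⟨h0, h1, h2, h3, h4⟩ | ⟨h0, h1, h2⟩ := hcases v hv <;> grind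
  refine card_lt_card ((ssubset_iff_of_subset ?_).2
    ⟨g x, mem_sdiff.2 ⟨hgxK, hgxA⟩, fun hmem => (mem_sdiff.1 hmem).2
      (mem_filter.2 ⟨hgxK, hxreach⟩)⟩)
  refine sdiff_subset_sdiff (Subset.refl _) fun X hX => mem_filter.2 ⟨hAK hX, ?_⟩
  by_cases hXW : X = W
  · exact hXW ▸ hWreach
  · exact hreach' X hX hXW

/-- A nearly equitable coloring can be made equitable if the proper subsets of `S` have equitable
colorings. -/
theorem NearlyEquitable.hasEquitable {a b : C} (hf : NearlyEquitable G S K s f a b)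
    (hdeg : ∀ v ∈ S, #(S.filter (G.Adj v)) < #K)
    (ih : ∀ S' ⊂ S, ∀ K' : Finset C, #S' = #K' * s →
      (∀ v ∈ S', #(S'.filter (G.Adj v)) < #K') → HasEquitable G S' K' s) :
    HasEquitable G S K s := by
  induction hn : #(K \ accessible G S f K a) using Nat.strong_induction_on generalizing f a b with
  | h n ihn =>
  subst hn
  by_cases hbA : b ∈ accessible G S f K a
  · exact hf.hasEquitable_of_accessible hbA
  have haA : a ∈ accessible G S f K a := mem_filter.2 ⟨hf.small_mem, .refl⟩
  have hB := hf.card_outside haA hbA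
  have hAcard : #(K \ accessible G S f K a) + #(accessible G S f K a) = #K :=
    card_sdiff_add_card_eq_card accessible_subset
  have hA1 := hf.one_lt_card_accessible hdeg hbA
  have hnot : ∀ y ∈ outside S f (accessible G S f K a), ∀ c ∈ accessible G S f K a,
      ¬ Movable G S f y c := by
    intro y hy c hc
    obtain ⟨hyS, hyA⟩ := mem_outside.1 hy
    exact not_movable_accessible hyS (hf.mem y hyS) hyA hc
  obtain ⟨U, hUA, T, hTA, hUT, haT, ⟨W₀, hW₀⟩, hterm, hexit⟩ :=
    RestrictRel.exists_terminal haA (fun c hc => reach_of_mem_accessible hc) hA1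
  have hAK : accessible G S f K a ⊆ K := accessible_subset
  have hrec := fun x y z Y W g => @card_sdiff_accessible_recolor_lt V C G S K a W Y z y x f g
  set A := accessible G S f K a with hA
  set B := outside S f A with hBdef
  set q := #(K \ A) with hq
  have hTs : ∀ W ∈ T, #(colorClass S f W) = s := fun W hW =>
    hf.card_other W (hAK (hTA hW)) (by rintro rfl; exact haT hW)
      (by rintro rfl; exact hbA (hTA hW))
  have hBS : ∀ y ∈ B, y ∈ S ∧ f y ∉ A := fun y hy => mem_outside.1 hy
  have hdB : ∀ y ∈ B, #(B.filter (G.Adj y)) + 1 ≤ q := by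
    intro y hy
    have h1 := card_add_card_outside_le (Subset.refl A) (hnot y hy)
    have h2 := hdeg y (hBS y hy).1
    rw [← hBdef] at h1
    omega
  have hrest : ∀ y ∈ B, HasEquitable G (B.erase y) (K \ A) s := by
    intro y hy
    refine ih _ ?_ _ ?_ ?_
    · exact (erase_ssubset hy).trans_subset (filter_subset _ _)
    · rw [card_erase_of_mem hy, hB, Nat.add_sub_cancel]
    · intro v hv
      have h1 := hdB v (mem_of_mem_erase hv)
      have h2 : #((B.erase y).filter (G.Adj v)) ≤ #(B.filter (G.Adj v)) :=
        card_le_card (filter_subset_filter _ (erase_subset _ _))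
      omega
  by_cases hsolo : ∃ z ∈ S, f z ∈ T ∧ ∃ y ∈ B, Solo G S f z y ∧
      ∃ X ∈ A, X ≠ f z ∧ Movable G S f z X
  · obtain ⟨z, hz, hzT, y, hy, hzy, X, hX, hXz, hzX⟩ := hsolo
    obtain ⟨g, hgK, hg, hgs⟩ := hrest y hy
    exact hasEquitable_of_solo_movable hf hAK hbA (hTA hzT) (by rintro rfl; exact haT hzT) hX hXz
      (hterm _ hzT X hX hXz) hz rfl hzX (hBS y hy).1 (hBS y hy).2
      (fun w hw hwz hyw => hzy.eq_of_adj hw hwz hyw) hgK hg hgs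
  push Not at hsolo
  have hdsolo : ∀ z ∈ S, f z ∈ T → ∀ y ∈ B, Solo G S f z y → #(B.filter (G.Adj z)) ≤ q := by
    intro z hz hzT y hy hzy
    have h1 := card_add_card_outside_le (erase_subset (f z) A) (G := G) (S := S) (v := z)
      fun c hc => hsolo z hz hzT y hy hzy c (mem_of_mem_erase hc) (mem_erase.1 hc).1
    have h2 := hdeg z hz
    rw [card_erase_of_mem (hTA hzT), ← hBdef] at h1
    omega
  have hqt : q < #T := by
    refine lt_of_solo_degree_le (hTs W₀ hW₀) hB (fun y hy => hnot y hy W₀ (hTA hW₀)) ?_ ?_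
    · intro w hw
      obtain ⟨hwS, hwW⟩ := mem_colorClass.1 hw
      have h1 := card_add_card_outside_le (A := A) (A' := (A \ T).erase U) (G := G) (S := S)
        (f := f) (v := w) ((erase_subset _ _).trans sdiff_subset) (by
          intro c hc hmov
          obtain ⟨hcU, hc⟩ := mem_erase.1 hc
          obtain ⟨hcA, hcT⟩ := mem_sdiff.1 hc
          exact hexit W₀ hW₀ c hcA hcT hcU ⟨w, hwS, hwW, hmov⟩)
      have h2 := hdeg w hwS
      have h3 := card_erase_add_one (mem_sdiff.2 ⟨hUA, hUT⟩)
      have h4 := card_sdiff_add_card_eq_card hTA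
      rw [← hBdef] at h1
      omega
    · intro w hw y hy hwy
      obtain ⟨hwS, hwW⟩ := mem_colorClass.1 hw
      exact hdsolo w hwS (hwW ▸ hW₀) y hy hwy
  by_cases hpair : ∃ z ∈ S, f z ∈ T ∧ ∃ y ∈ B, ∃ x ∈ B, Solo G S f z y ∧ Solo G S f z x ∧
      x ≠ y ∧ ¬ G.Adj x y
  · obtain ⟨z, hz, hzT, y, hy, x, hx, hzy, hzx, hxy, hnadj⟩ := hpair
    obtain ⟨g, hgK, hg, hgs⟩ := hrest y hy
    have hzA := hTA hzT
    have haz : a ≠ f z := by rintro rfl; exact haT hzT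
    have hY : ∃ Y ∈ K \ A, Movable G (B.erase y) g z Y := by
      by_contra! hcon
      have h1 := card_add_card_outside_le (Subset.refl (K \ A)) hcon
      have h2 := hdsolo z hz hzT y hy hzy
      have h3 : #((B.erase y).filter (G.Adj z)) < #(B.filter (G.Adj z)) := by
        rw [filter_erase]
        exact card_erase_lt_of_mem (mem_filter.2 ⟨hy, hzy.adj.symm⟩)
      omega
    obtain ⟨Y, hYK, hY⟩ := hY
    have hzy' : ∀ w ∈ S, f w = f z → G.Adj y w → w = z := fun w => hzy.eq_of_adj
    have hzx' : ∀ w ∈ S, f w = f z → G.Adj x w → w = z := fun w => hzx.eq_of_adj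
    have hnew := nearlyEquitable_recolor hf hAK hbA hzA haA haz hz rfl (hBS y hy).1 (hBS y hy).2
      hzy' hgK hg hgs hYK hY
    exact ihn _ (hrec x y z Y (f z) g hzA haz (hterm _ hzT) rfl (hsolo z hz hzT y hy hzy)
      (hBS y hy).2 hgK hYK (hBS x hx).1 (hBS x hx).2 hxy hnadj hzx') hnew rfl
  push Not at hpair
  exfalso
  refine false_of_weights (Z := S.filter fun z => f z ∈ T) (B := B) (R := Solo G S f)
    (d := fun y => #(B.filter (G.Adj y))) (s := s) hqt ?_ hB hdB ?_ ?_
  · rw [card_eq_sum_card_fiberwise (f := f) (t := T) (by intro v; simp), ← smul_eq_mul]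
    refine sum_const_nat (m := s) fun W hW => ?_
    rw [← hTs W hW]
    congr 1
    ext v
    simp
    grind
  · intro y hy
    have h1 := card_solo_add_le hTA (hnot y hy)
    have h2 := hdeg y (hBS y hy).1
    rw [← hBdef] at h1
    omega
  · intro y hy z hz hzy
    obtain ⟨hzS, hzT⟩ := mem_filter.1 hz
    refine (card_le_card ?_).trans (card_insert_le y (B.filter (G.Adj y)))
    intro x hx
    obtain ⟨hxB, hzx⟩ := mem_filter.1 hx
    by_cases hxy : x = y
    · simp [hxy]
    · simp [hxB, (hpair z hzS hzT y hy x hxB hzy hzx hxy).symm]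

theorem hasEquitable_bot [Nonempty C] (hS : #S = #K * s) :
    HasEquitable (⊥ : SimpleGraph V) S K s := by
  induction K using Finset.induction_on generalizing S with
  | empty =>
    obtain rfl : S = ∅ := by simpa using hS
    exact ⟨fun _ => Classical.arbitrary C, by simp, fun v hv => by simp at hv, by simp⟩
  | insert c K hc ih =>
    rw [card_insert_of_notMem hc, add_mul, one_mul] at hS
    obtain ⟨S₁, hS₁, hcard⟩ := exists_subset_card_eq (show s ≤ #S by omega)
    obtain ⟨f, hfK, -, hfs⟩ := ih (S := S \ S₁) (by rw [card_sdiff_of_subset hS₁]; omega)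
    have hfK' : ∀ v ∈ S, v ∉ S₁ → f v ∈ K := fun v hv hv₁ => hfK v (mem_sdiff.2 ⟨hv, hv₁⟩)
    refine ⟨fun v => if v ∈ S₁ then c else f v, ?_, fun v _ w _ h => by simp at h, ?_⟩
    · intro v hv
      have := hfK' v hv
      by_cases hv₁ : v ∈ S₁ <;> simp [hv₁, this]
    · intro d hd
      by_cases hdc : d = c
      · rw [← hcard]
        congr 1
        ext v
        have := hfK' v
        have := @hS₁ v
        simp only [mem_colorClass]
        grind
      · rw [← hfs d (mem_of_mem_insert_of_ne hd hdc)]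
        congr 1
        ext v
        simp only [mem_colorClass, mem_sdiff]
        grind

/-- The graph on the same vertices that keeps the edges of `G` inside `U`. -/
def edgesWithin (G : SimpleGraph V) (U : Finset V) : SimpleGraph V where
  Adj v w := G.Adj v w ∧ v ∈ U ∧ w ∈ U
  symm := ⟨fun _ _ h => ⟨h.1.symm, h.2.2, h.2.1⟩⟩
  loopless := ⟨fun _ h => h.1.ne rfl⟩

theorem hasEquitable_of_degree_lt [Nonempty C] (hS : #S = #K * s)
    (hdeg : ∀ v ∈ S, #(S.filter (G.Adj v)) < #K) : HasEquitable G S K s := by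
  induction S using Finset.strongInduction generalizing G K with
  | H S ih =>
  have hdegU : ∀ U : Finset V, ∀ v ∈ S, #(S.filter ((edgesWithin G U).Adj v)) < #K := by
    intro U v hv
    refine (card_le_card fun w hw => ?_).trans_lt (hdeg v hv)
    obtain ⟨hw, hvw⟩ := mem_filter.1 hw
    exact mem_filter.2 ⟨hw, hvw.1⟩
  have key : ∀ U : Finset V, U ⊆ S → HasEquitable (edgesWithin G U) S K s := by
    intro U
    induction U using Finset.induction_on with
    | empty =>
      intro _
      have h : edgesWithin G ∅ = ⊥ := by
        ext v w
        simp [edgesWithin]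
      rw [h]
      exact hasEquitable_bot hS
    | insert u U hu ihU =>
      intro hUS
      obtain ⟨f, hfK, hf, hfs⟩ := ihU ((subset_insert _ _).trans hUS)
      have huS : u ∈ S := hUS (mem_insert_self _ _)
      obtain ⟨c, hcK, hc⟩ : ∃ c ∈ K, Movable (edgesWithin G (insert u U)) S f u c := by
        by_contra! hcon
        have h1 := card_add_card_outside_le (Subset.refl K) hcon
        have h2 := hdegU (insert u U) u huS
        omega
      have hproper : ProperOn (edgesWithin G (insert u U)) S (Function.update f u c) := by
        intro v hv w hw hvw
        by_cases hvu : v = u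
        · subst hvu
          rw [Function.update_self, Function.update_of_ne hvw.ne']
          exact fun h => hc w hw h.symm hvw
        rw [Function.update_of_ne hvu]
        by_cases hwu : w = u
        · subst hwu
          rw [Function.update_self]
          exact fun h => hc v hv h hvw.symm
        rw [Function.update_of_ne hwu]
        exact hf v hv w hw ⟨hvw.1, mem_of_mem_insert_of_ne hvw.2.1 hvu,
          mem_of_mem_insert_of_ne hvw.2.2 hwu⟩
      have hmem : ∀ v ∈ S, Function.update f u c v ∈ K := by
        intro v hv
        by_cases hvu : v = u
        · subst hvu
          simpa using hcK
        · rw [Function.update_of_ne hvu]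
          exact hfK v hv
      by_cases hcu : c = f u
      · refine ⟨_, hmem, hproper, ?_⟩
        rwa [hcu, Function.update_eq_self]
      have hcard := card_colorClass_update huS rfl hcu
      have hnear : NearlyEquitable (edgesWithin G (insert u U)) S K s (Function.update f u c)
          (f u) c := by
        refine ⟨hmem, hproper, hfK u huS, hcK, Ne.symm hcu, ?_, ?_, ?_⟩
        · simpa [hfs _ (hfK u huS), Ne.symm hcu] using hcard (f u)
        · simpa [hfs _ hcK, hcu] using hcard c
        · intro d hd hdu hdc
          simpa [hfs _ hd, hdu, hdc] using hcard d
      exact hnear.hasEquitable (hdegU _) fun S' hS' K' hcard' hdeg' => ih S' hS' hcard' hdeg'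
  obtain ⟨f, hfK, hf, hfs⟩ := key S (Subset.refl S)
  exact ⟨f, hfK, fun v hv w hw hvw => hf v hv w hw ⟨hvw, hv, hw⟩, hfs⟩

end EquitableColoring

/-- Hajnal–Szemerédi: every finite simple graph on `k` vertices with
maximum degree `Δ` admits a proper coloring with `Δ + 1` colors in which every color
class has size `⌊k/(Δ+1)⌋` or `⌈k/(Δ+1)⌉`. -/
theorem stmt_1 {V : Type*} [Fintype V] [DecidableEq V]
    (G : SimpleGraph V) [DecidableRel G.Adj] (k Δ : ℕ)
    (hk : Fintype.card V = k) (hΔ : G.maxDegree = Δ) :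
    ∃ c : V → Fin (Δ + 1),
      (∀ v w, G.Adj v w → c v ≠ c w) ∧
      (∀ col : Fin (Δ + 1),
        (Finset.univ.filter (fun v => c v = col)).card = k / (Δ + 1) ∨
        (Finset.univ.filter (fun v => c v = col)).card = (k + Δ) / (Δ + 1)) := by
  classical
  obtain ⟨s, p, hsp, hp, hs⟩ : ∃ s p, (Δ + 1) * s = k + p ∧ p ≤ Δ ∧ s = (k + Δ) / (Δ + 1) := by
    have h1 := Nat.div_add_mod (k + Δ) (Δ + 1)
    have h2 := Nat.mod_lt (k + Δ) (show Δ + 1 > 0 by omega)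
    exact ⟨(k + Δ) / (Δ + 1), Δ - (k + Δ) % (Δ + 1), by omega, by omega, rfl⟩
  have hdeg : ∀ v : V ⊕ Fin p, (Finset.univ.filter ((G ⊕g (⊤ : SimpleGraph (Fin p))).Adj v)).card <
      (Finset.univ : Finset (Fin (Δ + 1))).card := by
    rw [Finset.card_fin]
    rintro (v | i)
    · have h1 : Finset.univ.filter ((G ⊕g (⊤ : SimpleGraph (Fin p))).Adj (Sum.inl v)) ⊆
          (G.neighborFinset v).map Function.Embedding.inl := by
        rintro (w | j) h <;> simp_all
      have h2 := Finset.card_le_card h1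
      rw [Finset.card_map, G.card_neighborFinset_eq_degree] at h2
      have h3 := G.degree_le_maxDegree v
      omega
    · have h1 : Finset.univ.filter ((G ⊕g (⊤ : SimpleGraph (Fin p))).Adj (Sum.inr i)) ⊆
          (Finset.univ : Finset (Fin p)).map Function.Embedding.inr := by
        rintro (w | j) h <;> simp_all
      have h2 := Finset.card_le_card h1
      rw [Finset.card_map, Finset.card_fin] at h2
      omega
  obtain ⟨f, -, hf, hfs⟩ := hasEquitable_of_degree_lt (C := Fin (Δ + 1)) (K := Finset.univ)
    (S := Finset.univ) (s := s) (G := G ⊕g (⊤ : SimpleGraph (Fin p)))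
    (by simp [hk, hsp]) (fun v _ => by convert hdeg v)
  refine ⟨fun v => f (Sum.inl v), fun v w hvw => ?_, fun c => ?_⟩
  · exact hf _ (Finset.mem_univ _) _ (Finset.mem_univ _) (by simpa using hvw)
  have hcard : (Finset.univ.filter fun v => f (Sum.inl v) = c).card +
      (Finset.univ.filter fun i => f (Sum.inr i) = c).card = s := by
    rw [← hfs c (Finset.mem_univ c), colorClass, Finset.card_filter, Finset.card_filter,
      Finset.card_filter, Fintype.sum_sum_type]
    congr!
  have hone : (Finset.univ.filter fun i => f (Sum.inr i) = c).card ≤ 1 := by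
    refine Finset.card_le_one.2 fun i hi j hj => ?_
    by_contra hij
    refine hf (Sum.inr i) (Finset.mem_univ _) (Sum.inr j) (Finset.mem_univ _) (by simpa using hij) ?_
    simp_all
  have hple : (Finset.univ.filter fun i => f (Sum.inr i) = c).card ≤ p :=
    (Finset.card_le_univ _).trans_eq (Fintype.card_fin p)
  beta_reduce
  obtain h0 | h1 : (Finset.univ.filter fun i => f (Sum.inr i) = c).card = 0 ∨
      (Finset.univ.filter fun i => f (Sum.inr i) = c).card = 1 := by omega
  · right
    omega
  · left
    rw [h1] at hcard hple
    refine (Nat.div_eq_of_lt_le ?_ ?_).symm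
    · nlinarith
    · rw [hcard]
      nlinarith
end

section
/- Let A be the k × n 'left-shifted' symmetric Toeplitz-type matrix with rows A[i][j] determined by A[i][j] = a_{i+j−1} for i+j−1 ≤ n and A[i][j] = a_{2n−(i+j−1)} for i+j−1 > n, generated by i.i.d. entries a_1,...,a_n from N(0,1/k). Then each row of any 3m-column submatrix A_T shares generating variables with at most 3m(6m−1) other rows, and consequently A satisfies RIP of order 3m with constant δ ∈ (0,1/3) with probability at least 1 − e^{−c_2 k/m²} whenever k ≥ c_1 m³ ln(n/m), for constants c_1, c_2 > 0 depending only on δ. -/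
open MeasureTheory ProbabilityTheory

/-- The `k × n` 'left-shifted' symmetric Toeplitz-type matrix of Corollary 2.3:
entry `(i,j)` (1-based) equals `a_{min(i+j-1, 2n-(i+j-1))}`; in 0-based indices the
generating index of entry `(i,j)` is `min (i+j+1) (2n-(i+j+1)) - 1`. -/
def leftShiftToeplitz (k n : ℕ) (hk : k ≤ n) (a : Fin n → ℝ) :
    Matrix (Fin k) (Fin n) ℝ :=
  Matrix.of fun i j =>
    a ⟨min (i.val + j.val + 1) (2 * n - (i.val + j.val + 1)) - 1,
      by have hi := i.isLt; have hj := j.isLt; omega⟩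

theorem exp_le_one_add_add_sq_mul_exp_abs (x : ℝ) :
    Real.exp x ≤ 1 + x + x ^ 2 * Real.exp |x| := by
  have h1 : 1 ≤ Real.exp |x| := Real.one_le_exp (abs_nonneg x)
  rcases le_total |x| 1 with h | h
  · have := (abs_le.1 (Real.abs_exp_sub_one_sub_id_le h)).2
    nlinarith [sq_nonneg x]
  · rcases le_abs'.1 h with h2 | h2
    · have h3 : Real.exp x ≤ 1 := Real.exp_le_one_iff.2 (by linarith)
      nlinarith [sq_nonneg x]
    · rw [abs_of_nonneg (by linarith)] at h1 ⊢
      nlinarith [mul_nonneg (sub_nonneg.2 (one_le_pow₀ h2 (n := 2))) (Real.exp_pos x).le]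

theorem exp_mul_le_of_abs_le {s : ℝ} (hs : |s| ≤ 1 / 16) (y : ℝ) :
    Real.exp (s * y) ≤ 1 + s * y + 512 * s ^ 2 * Real.exp (|y| / 8) := by
  have h1 := exp_le_one_add_add_sq_mul_exp_abs (s * y)
  have hy := abs_nonneg y
  have h2 : |s * y| ≤ |y| / 16 := by
    rw [abs_mul]; nlinarith
  have h3 := Real.quadratic_le_exp_of_nonneg (x := |y| / 16) (by positivity)
  have h4 : y ^ 2 ≤ 512 * Real.exp (|y| / 16) := by
    rw [← sq_abs y]; nlinarith
  have h5 : Real.exp (|y| / 8) = Real.exp (|y| / 16) * Real.exp (|y| / 16) := by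
    rw [← Real.exp_add]; ring_nf
  have h6 : (s * y) ^ 2 * Real.exp |s * y| ≤
      s ^ 2 * (512 * Real.exp (|y| / 16)) * Real.exp (|y| / 16) := by
    rw [mul_pow]; gcongr
  rw [h5]
  linarith

section
variable {Ω : Type*} [MeasurableSpace Ω] {μ : Measure Ω} {Y : Ω → ℝ} {M s : ℝ}

theorem integrable_exp_mul_of_integrable_exp_abs (hY : Measurable Y)
    (hexp : Integrable (fun ω => Real.exp (|Y ω| / 8)) μ) (hs : |s| ≤ 1 / 16) :
    Integrable (fun ω => Real.exp (s * Y ω)) μ := by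
  refine hexp.mono' (by fun_prop) (.of_forall fun ω => ?_)
  rw [Real.norm_eq_abs, Real.abs_exp]
  gcongr
  calc s * Y ω ≤ |s * Y ω| := le_abs_self _
    _ = |s| * |Y ω| := abs_mul _ _
    _ ≤ |Y ω| / 8 := by nlinarith [abs_nonneg (Y ω)]

theorem mgf_le_exp_sq_of_centered [IsProbabilityMeasure μ] (hY : Measurable Y)
    (hint : Integrable Y μ) (hmean : ∫ ω, Y ω ∂μ = 0)
    (hexp : Integrable (fun ω => Real.exp (|Y ω| / 8)) μ)
    (hM : ∫ ω, Real.exp (|Y ω| / 8) ∂μ ≤ M) (hs : |s| ≤ 1 / 16) :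
    mgf Y μ s ≤ Real.exp (512 * M * s ^ 2) := by
  have hlin : Integrable (fun ω => 1 + s * Y ω) μ := (integrable_const 1).add (hint.const_mul s)
  calc mgf Y μ s
      ≤ ∫ ω, (1 + s * Y ω + 512 * s ^ 2 * Real.exp (|Y ω| / 8)) ∂μ :=
        integral_mono (integrable_exp_mul_of_integrable_exp_abs hY hexp hs)
          (hlin.add (hexp.const_mul _)) fun ω => exp_mul_le_of_abs_le hs (Y ω)
    _ = 1 + 512 * s ^ 2 * ∫ ω, Real.exp (|Y ω| / 8) ∂μ := by
        rw [integral_add hlin (hexp.const_mul _), integral_add (integrable_const 1)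
          (hint.const_mul s), integral_const_mul, integral_const_mul, hmean]
        simp
    _ ≤ 512 * M * s ^ 2 + 1 := by nlinarith [sq_nonneg s]
    _ ≤ Real.exp (512 * M * s ^ 2) := Real.add_one_le_exp _

/-- A Bernstein-type upper tail bound for sums of independent variables whose moment generating
functions are sub-Gaussian near the origin. -/
theorem measureReal_sum_ge_le_of_mgf_le {J : Type*} [Fintype J] [IsProbabilityMeasure μ]
    {Z : J → Ω → ℝ} (hindep : iIndepFun Z μ) (hmeas : ∀ j, Measurable (Z j))
    (hint : ∀ s : ℝ, |s| ≤ 1 / 16 → ∀ j, Integrable (fun ω => Real.exp (s * Z j ω)) μ)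
    (hmgf : ∀ s : ℝ, |s| ≤ 1 / 16 → ∀ j, mgf (Z j) μ s ≤ Real.exp (2048 * s ^ 2))
    {N : ℕ} (hN : Fintype.card J ≤ N) {ε : ℝ} (hε0 : 0 ≤ ε) (hε1 : ε ≤ 1) :
    μ.real {ω | ε * N ≤ ∑ j, Z j ω} ≤ Real.exp (-(ε ^ 2 * N / 8192)) := by
  have hs : |ε / 4096| ≤ 1 / 16 := by rw [abs_of_nonneg (by positivity)]; linarith
  have hI : Integrable (fun ω => Real.exp (ε / 4096 * (∑ j, Z j) ω)) μ :=
    hindep.integrable_exp_mul_sum hmeas fun j _ => hint _ hs j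
  have h := measure_ge_le_exp_mul_mgf (X := ∑ j, Z j) (μ := μ) (ε * N)
    (by positivity : 0 ≤ ε / 4096) hI
  simp only [Finset.sum_apply] at h
  refine h.trans ?_
  rw [hindep.mgf_sum hmeas]
  have hprod : ∏ j, mgf (Z j) μ (ε / 4096) ≤ Real.exp (2048 * (ε / 4096) ^ 2 * N) :=
    calc ∏ j, mgf (Z j) μ (ε / 4096) ≤ ∏ _j : J, Real.exp (2048 * (ε / 4096) ^ 2) :=
          Finset.prod_le_prod (fun _ _ => mgf_nonneg) fun j _ => hmgf _ hs j
      _ = Real.exp (2048 * (ε / 4096) ^ 2 * Fintype.card J) := by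
          rw [Finset.prod_const, ← Real.exp_nat_mul, Finset.card_univ]; ring_nf
      _ ≤ _ := by gcongr
  calc Real.exp (-(ε / 4096) * (ε * N)) * ∏ j, mgf (Z j) μ (ε / 4096)
      ≤ Real.exp (-(ε / 4096) * (ε * N)) * Real.exp (2048 * (ε / 4096) ^ 2 * N) := by gcongr
    _ = _ := by rw [← Real.exp_add]; ring_nf

end

section
open scoped NNReal
variable {v : ℝ≥0}

theorem gaussianPDFReal_mul_exp_sq (hv : v ≠ 0) (x : ℝ) :
    gaussianPDFReal 0 v x * Real.exp (x ^ 2 / (8 * v)) =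
      (√(2 * Real.pi * v))⁻¹ * Real.exp (-(3 / (8 * v)) * x ^ 2) := by
  have hv' : (v : ℝ) ≠ 0 := by exact_mod_cast hv
  rw [gaussianPDFReal, mul_assoc, ← Real.exp_add]
  congr 2
  field_simp
  ring

theorem integrable_exp_sq_gaussianReal (hv : v ≠ 0) :
    Integrable (fun x => Real.exp (x ^ 2 / (8 * v))) (gaussianReal 0 v) := by
  have hv' : (0 : ℝ) < v := by exact_mod_cast pos_iff_ne_zero.2 hv
  rw [gaussianReal_of_var_ne_zero 0 hv, integrable_withDensity_iff_integrable_smul'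
    (measurable_gaussianPDF 0 v) (.of_forall fun _ => gaussianPDF_lt_top)]
  simp only [toReal_gaussianPDF, smul_eq_mul, gaussianPDFReal_mul_exp_sq hv]
  exact (integrable_exp_neg_mul_sq (by positivity)).const_mul _

theorem integral_exp_sq_gaussianReal_le (hv : v ≠ 0) :
    ∫ x, Real.exp (x ^ 2 / (8 * v)) ∂gaussianReal 0 v ≤ 2 := by
  have hv' : (0 : ℝ) < v := by exact_mod_cast pos_iff_ne_zero.2 hv
  rw [integral_gaussianReal_eq_integral_smul hv]
  simp only [smul_eq_mul, gaussianPDFReal_mul_exp_sq hv]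
  rw [integral_const_mul, integral_gaussian, ← Real.sqrt_inv, ← Real.sqrt_mul (by positivity)]
  refine Real.sqrt_le_iff.2 ⟨by norm_num, ?_⟩
  have : (2 * Real.pi * v : ℝ)⁻¹ * (Real.pi / (3 / (8 * v))) = 4 / 3 := by
    field_simp
    norm_num
  rw [this]; norm_num

variable {ι : Type*}

/-- The normalized centered product of two coordinates of a Gaussian vector of variance `v`. -/
noncomputable def centeredProd [DecidableEq ι] (v : ℝ≥0) (u w : ι) (a : ι → ℝ) : ℝ :=
  a u * a w / v - if u = w then 1 else 0

theorem measurable_centeredProd [DecidableEq ι] (u w : ι) : Measurable (centeredProd v u w) := by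
  unfold centeredProd; fun_prop

theorem exp_abs_centeredProd_le [DecidableEq ι] (hv : v ≠ 0) (u w : ι) (a : ι → ℝ) :
    Real.exp (|centeredProd v u w a| / 8) ≤
      Real.exp (a u ^ 2 / (8 * v)) + Real.exp (a w ^ 2 / (8 * v)) := by
  have hv' : (0 : ℝ) < v := by exact_mod_cast pos_iff_ne_zero.2 hv
  have h1 : |centeredProd v u w a| ≤ (a u ^ 2 / v + a w ^ 2 / v) / 2 + 1 := by
    unfold centeredProd
    refine (abs_sub _ _).trans (add_le_add ?_ (by split_ifs <;> simp))
    rw [abs_div, abs_of_pos hv', ← add_div, div_right_comm]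
    gcongr
    rw [abs_mul]
    nlinarith [sq_nonneg (|a u| - |a w|), sq_abs (a u), sq_abs (a w)]
  set p := Real.exp (a u ^ 2 / (16 * v)) with hp
  set q := Real.exp (a w ^ 2 / (16 * v)) with hq
  have h2 : Real.exp (a u ^ 2 / (8 * v)) = p ^ 2 := by
    rw [hp, ← Real.exp_nat_mul]; congr 1; push_cast; field_simp; ring
  have h3 : Real.exp (a w ^ 2 / (8 * v)) = q ^ 2 := by
    rw [hq, ← Real.exp_nat_mul]; congr 1; push_cast; field_simp; ring
  have h4 : Real.exp (1 / 8) ≤ 2 := by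
    have := Real.exp_bound_div_one_sub_of_interval (x := 1 / 8) (by norm_num) (by norm_num)
    norm_num at this ⊢
    linarith
  calc Real.exp (|centeredProd v u w a| / 8)
      ≤ Real.exp (a u ^ 2 / (16 * v) + a w ^ 2 / (16 * v) + 1 / 8) := by
        gcongr
        have e (x : ℝ) : x / (16 * v) = x / v / 16 := by field_simp
        rw [e, e]; linarith
    _ = p * q * Real.exp (1 / 8) := by rw [Real.exp_add, Real.exp_add]
    _ ≤ p * q * 2 := by gcongr
    _ ≤ _ := by rw [h2, h3]; nlinarith [sq_nonneg (p - q)]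

variable [Fintype ι]

theorem integral_eval_mul_eval_pi_gaussianReal [DecidableEq ι] (u w : ι) :
    ∫ a : ι → ℝ, a u * a w ∂(Measure.pi fun _ => gaussianReal 0 v) =
      if u = w then (v : ℝ) else 0 := by
  split_ifs with h
  · subst h
    rw [integral_comp_eval (μ := fun _ : ι => gaussianReal 0 v) (i := u) (f := fun x : ℝ => x * x)
      (by fun_prop)]
    have h1 := variance_id_gaussianReal (μ := 0) (v := v)
    rw [variance_eq_integral (by fun_prop)] at h1
    simpa [integral_id_gaussianReal, sq] using h1
  · have hI : iIndepFun (fun i (a : ι → ℝ) => a i) (Measure.pi fun _ => gaussianReal 0 v) :=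
      iIndepFun_pi (X := fun _ x => x) fun _ => by fun_prop
    rw [(hI.indepFun h).integral_fun_mul_eq_mul_integral
      (measurable_pi_apply u).aestronglyMeasurable (measurable_pi_apply w).aestronglyMeasurable,
      integral_comp_eval (μ := fun _ : ι => gaussianReal 0 v) (i := u) (f := fun x : ℝ => x)
      (by fun_prop), integral_id_gaussianReal, zero_mul]

theorem integrable_eval_mul_eval_pi_gaussianReal (u w : ι) :
    Integrable (fun a : ι → ℝ => a u * a w) (Measure.pi fun _ => gaussianReal 0 v) := by
  have h (i : ι) : MemLp (fun a : ι → ℝ => a i) 2 (Measure.pi fun _ => gaussianReal 0 v) :=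
    (memLp_id_gaussianReal' 2 (by simp)).comp_measurePreserving
      (measurePreserving_eval (fun _ : ι => gaussianReal 0 v) i)
  exact (h u).integrable_mul (h w)

theorem integrable_centeredProd [DecidableEq ι] (u w : ι) :
    Integrable (centeredProd v u w) (Measure.pi fun _ => gaussianReal 0 v) :=
  ((integrable_eval_mul_eval_pi_gaussianReal u w).div_const _).sub (integrable_const _)

theorem integral_centeredProd [DecidableEq ι] (hv : v ≠ 0) (u w : ι) :
    ∫ a, centeredProd v u w a ∂(Measure.pi fun _ => gaussianReal 0 v) = 0 := by
  have hv' : (v : ℝ) ≠ 0 := by exact_mod_cast hv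
  unfold centeredProd
  rw [integral_sub ((integrable_eval_mul_eval_pi_gaussianReal u w).div_const _)
    (integrable_const _), integral_div, integral_eval_mul_eval_pi_gaussianReal]
  split_ifs <;> simp [hv']

theorem integrable_exp_sq_eval_pi_gaussianReal (hv : v ≠ 0) (u : ι) :
    Integrable (fun a : ι → ℝ => Real.exp (a u ^ 2 / (8 * v)))
      (Measure.pi fun _ => gaussianReal 0 v) :=
  integrable_comp_eval (μ := fun _ : ι => gaussianReal 0 v) (i := u)
    (integrable_exp_sq_gaussianReal hv)

theorem integral_exp_sq_eval_pi_gaussianReal_le (hv : v ≠ 0) (u : ι) :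
    ∫ a : ι → ℝ, Real.exp (a u ^ 2 / (8 * v)) ∂(Measure.pi fun _ => gaussianReal 0 v) ≤ 2 := by
  rw [integral_comp_eval (μ := fun _ : ι => gaussianReal 0 v) (i := u)
    (f := fun x : ℝ => Real.exp (x ^ 2 / (8 * v))) (by fun_prop)]
  exact integral_exp_sq_gaussianReal_le hv

theorem integrable_exp_abs_centeredProd [DecidableEq ι] (hv : v ≠ 0) (u w : ι) :
    Integrable (fun a => Real.exp (|centeredProd v u w a| / 8))
      (Measure.pi fun _ => gaussianReal 0 v) := by
  have := measurable_centeredProd (v := v) u w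
  refine ((integrable_exp_sq_eval_pi_gaussianReal hv u).add
    (integrable_exp_sq_eval_pi_gaussianReal hv w)).mono' (by fun_prop) (.of_forall fun a => ?_)
  rw [Real.norm_eq_abs, Real.abs_exp]
  exact exp_abs_centeredProd_le hv u w a

theorem mgf_centeredProd_le [DecidableEq ι] (hv : v ≠ 0) (u w : ι) {s : ℝ} (hs : |s| ≤ 1 / 16) :
    mgf (centeredProd v u w) (Measure.pi fun _ => gaussianReal 0 v) s ≤
      Real.exp (2048 * s ^ 2) := by
  have hu := integrable_exp_sq_eval_pi_gaussianReal hv u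
  have hw := integrable_exp_sq_eval_pi_gaussianReal hv w
  have h : ∫ a, Real.exp (|centeredProd v u w a| / 8) ∂(Measure.pi fun _ => gaussianReal 0 v)
      ≤ 4 := by
    refine (integral_mono (integrable_exp_abs_centeredProd hv u w) (hu.add hw)
      (exp_abs_centeredProd_le hv u w)).trans ?_
    simp only [Pi.add_apply]
    rw [integral_add hu hw]
    linarith [integral_exp_sq_eval_pi_gaussianReal_le hv u,
      integral_exp_sq_eval_pi_gaussianReal_le hv w]
  refine (mgf_le_exp_sq_of_centered (measurable_centeredProd u w) (integrable_centeredProd u w)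
    (integral_centeredProd hv u w) (integrable_exp_abs_centeredProd hv u w) h hs).trans_eq ?_
  norm_num


theorem iIndep_iSup_of_pairwise_disjoint {Ω ι J : Type*} {mΩ : MeasurableSpace Ω} {μ : Measure Ω}
    [IsProbabilityMeasure μ] {m : ι → MeasurableSpace Ω} (hle : ∀ i, m i ≤ mΩ) (h : iIndep m μ)
    {B : J → Set ι} (hB : Pairwise (Function.onFun Disjoint B)) :
    iIndep (fun j => ⨆ i ∈ B j, m i) μ := by
  classical
  rw [iIndep_iff]
  intro s f hf
  induction s using Finset.induction_on with
  | empty => simp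
  | insert j s hj ih =>
    have hs : ∀ i ∈ s, MeasurableSet[⨆ l ∈ B i, m l] (f i) :=
      fun i hi => hf i (Finset.mem_insert_of_mem hi)
    have hdisj : Disjoint (B j) (⋃ l ∈ s, B l) :=
      Set.disjoint_iUnion₂_right.2 fun l hl => hB (ne_of_mem_of_not_mem hl hj).symm
    have hind := (Indep_iff _ _ _).1 (indep_iSup_of_disjoint hle h hdisj)
    rw [Finset.set_biInter_insert, Finset.prod_insert hj, ← ih hs]
    refine hind _ _ (hf j (Finset.mem_insert_self j s)) ?_
    refine Finset.measurableSet_biInter s fun l hl => ?_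
    have hmono : (⨆ i ∈ B l, m i) ≤ ⨆ i ∈ ⋃ l ∈ s, B l, m i :=
      biSup_mono fun i hi => Set.mem_biUnion hl hi
    exact hmono _ (hs l hl)

section
variable [DecidableEq ι] {κ R : Type*} [Fintype R]

theorem iIndepFun_centeredProd {J : Type*} {u w : J → ι}
    (h : Pairwise fun i j => Disjoint ({u i, w i} : Set ι) {u j, w j}) :
    iIndepFun (fun j => centeredProd v (u j) (w j)) (Measure.pi fun _ => gaussianReal 0 v) := by
  have hI : iIndepFun (fun i (a : ι → ℝ) => a i) (Measure.pi fun _ => gaussianReal 0 v) :=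
    iIndepFun_pi (X := fun _ x => x) fun _ => by fun_prop
  have hJ := iIndep_iSup_of_pairwise_disjoint
    (fun i => (measurable_pi_apply i).comap_le) ((iIndepFun_iff_iIndep _ _ _).1 hI) h
  rw [iIndepFun_iff]
  intro s f hf
  refine (iIndep_iff _ _).1 hJ s fun j hj => ?_
  have hmeas (i : ι) (hi : i ∈ ({u j, w j} : Set ι)) :
      Measurable[⨆ i ∈ ({u j, w j} : Set ι), MeasurableSpace.comap (fun a : ι → ℝ => a i)
        inferInstance] fun a : ι → ℝ => a i :=
    Measurable.mono (comap_measurable _) (le_iSup₂_of_le i hi le_rfl) le_rfl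
  have hZ : Measurable[⨆ i ∈ ({u j, w j} : Set ι), MeasurableSpace.comap (fun a : ι → ℝ => a i)
      inferInstance] (centeredProd v (u j) (w j)) :=
    (((hmeas _ (by simp)).mul (hmeas _ (by simp))).div_const _).sub_const _
  obtain ⟨t, ht, hft⟩ := hf j hj
  rw [← hft]
  exact hZ ht

theorem measureReal_sum_centeredProd_ge_le {J : Type*} [Fintype J] (hv : v ≠ 0) {u w : J → ι}
    (h : Pairwise fun i j => Disjoint ({u i, w i} : Set ι) {u j, w j})
    {N : ℕ} (hN : Fintype.card J ≤ N) {ε : ℝ} (hε0 : 0 ≤ ε) (hε1 : ε ≤ 1) :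
    (Measure.pi fun _ => gaussianReal 0 v).real
        {a | ε * N ≤ |∑ j, centeredProd v (u j) (w j) a|} ≤
      2 * Real.exp (-(ε ^ 2 * N / 8192)) := by
  set μ : Measure (ι → ℝ) := Measure.pi fun _ => gaussianReal 0 v
  have hm (j : J) := measurable_centeredProd (v := v) (u j) (w j)
  have hint (s : ℝ) (hs : |s| ≤ 1 / 16) (j : J) :
      Integrable (fun a => Real.exp (s * centeredProd v (u j) (w j) a)) μ :=
    integrable_exp_mul_of_integrable_exp_abs (hm j)
      (integrable_exp_abs_centeredProd hv (u j) (w j)) hs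
  have hup := measureReal_sum_ge_le_of_mgf_le (iIndepFun_centeredProd (v := v) h) hm hint
    (fun s hs j => mgf_centeredProd_le hv (u j) (w j) hs) hN hε0 hε1
  have hlo := measureReal_sum_ge_le_of_mgf_le (μ := μ)
    (Z := fun j a => -centeredProd v (u j) (w j) a)
    ((iIndepFun_centeredProd (v := v) h).comp (fun _ x => -x) fun _ => measurable_neg)
    (fun j => (hm j).neg)
    (fun s hs j => by simpa using hint (-s) (by rwa [abs_neg]) j)
    (fun s hs j => by
      have := mgf_centeredProd_le hv (u j) (w j) (s := -s) (by rwa [abs_neg])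
      rw [neg_sq, ← mgf_neg] at this
      exact this) hN hε0 hε1
  calc μ.real {a | ε * N ≤ |∑ j, centeredProd v (u j) (w j) a|}
      ≤ μ.real ({a | ε * N ≤ ∑ j, centeredProd v (u j) (w j) a} ∪
          {a | ε * N ≤ ∑ j, -centeredProd v (u j) (w j) a}) := by
        refine measureReal_mono fun a ha => ?_
        simpa only [Set.mem_union, Set.mem_ofPred_eq, Finset.sum_neg_distrib, le_abs] using ha
    _ ≤ _ := measureReal_union_le _ _
    _ ≤ _ := by rw [two_mul]; exact add_le_add hup hlo

/-- Tail bound for sums of centered products whose dependency graph is properly coloured by `c`. -/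
theorem measureReal_sum_centeredProd_gt_le_of_coloring [Fintype κ] [DecidableEq κ] (hv : v ≠ 0)
    {u w : R → ι} (c : R → κ)
    (h : ∀ i j, i ≠ j → c i = c j → Disjoint ({u i, w i} : Set ι) {u j, w j})
    {ε : ℝ} (hε0 : 0 ≤ ε) (hε1 : ε ≤ 1) :
    (Measure.pi fun _ => gaussianReal 0 v).real
        {a | Fintype.card κ * (ε * Fintype.card R) < |∑ i, centeredProd v (u i) (w i) a|} ≤
      Fintype.card κ * (2 * Real.exp (-(ε ^ 2 * Fintype.card R / 8192))) := by
  set μ : Measure (ι → ℝ) := Measure.pi fun _ => gaussianReal 0 v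
  let E (x : κ) : Set (ι → ℝ) :=
    {a | ε * Fintype.card R ≤ |∑ i : {i // c i = x}, centeredProd v (u i) (w i) a|}
  calc _ ≤ μ.real (⋃ x, E x) := by
        refine measureReal_mono fun a ha => ?_
        by_contra hE
        simp only [E, Set.mem_iUnion, Set.mem_ofPred_eq, not_exists, not_le] at ha hE
        rw [← Fintype.sum_fiberwise c (fun i => centeredProd v (u i) (w i) a)] at ha
        refine ha.not_ge ((Finset.abs_sum_le_sum_abs _ _).trans ?_)
        refine (Finset.sum_le_card_nsmul _ _ _ fun x _ => (hE x).le).trans_eq ?_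
        rw [nsmul_eq_mul, Finset.card_univ]
    _ ≤ ∑ x, μ.real (E x) := measureReal_iUnion_fintype_le _
    _ ≤ ∑ _x : κ, 2 * Real.exp (-(ε ^ 2 * Fintype.card R / 8192)) := by
        refine Finset.sum_le_sum fun x _ => ?_
        exact measureReal_sum_centeredProd_ge_le (J := {i // c i = x}) hv
          (fun i j hij => h i j (by simpa [Subtype.ext_iff] using hij) (i.2.trans j.2.symm))
          (Fintype.card_subtype_le _) hε0 hε1
    _ = _ := by rw [Finset.sum_const, nsmul_eq_mul, Finset.card_univ]

end

end

/-- The 0-based index of the variable in entry `(i, j)` of the left-shifted Toeplitz matrix. -/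
def leftShiftIndex {k n : ℕ} (hk : k ≤ n) (i : Fin k) (j : Fin n) : Fin n :=
  ⟨min (i.val + j.val + 1) (2 * n - (i.val + j.val + 1)) - 1, by omega⟩

theorem leftShiftIndex_eq_iff {k n : ℕ} (hk : k ≤ n) (i i' : Fin k) (j j' : Fin n) :
    leftShiftIndex hk i j = leftShiftIndex hk i' j' ↔
      i.val + j.val = i'.val + j'.val ∨ i.val + j.val + i'.val + j'.val + 2 = 2 * n := by
  simp only [leftShiftIndex, Fin.mk.injEq]
  omega

/-- Two distinct rows of the same colour use disjoint sets of variables in columns `j` and `j'`. -/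
def rowColor (n j j' i : ℕ) : Bool × Bool × Bool × Bool :=
  (decide (i / Nat.dist j j' % 2 = 0), decide (2 * i + 2 * j + 2 < 2 * n),
    decide (2 * i + j + j' + 2 < 2 * n), decide (2 * i + 2 * j' + 2 < 2 * n))

theorem add_div_dist_parity {j j' i i' : ℕ} (hne : i ≠ i') (h : i + j = i' + j') :
    ¬(i / Nat.dist j j' % 2 = 0 ↔ i' / Nat.dist j j' % 2 = 0) := by
  rcases lt_or_gt_of_ne hne with hlt | hlt
  · have hd : 0 < Nat.dist j j' := by unfold Nat.dist; omega
    have : i' = i + Nat.dist j j' := by unfold Nat.dist; omega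
    rw [this, Nat.add_div_right _ hd]
    omega
  · have hd : 0 < Nat.dist j j' := by unfold Nat.dist; omega
    have : i = i' + Nat.dist j j' := by unfold Nat.dist; omega
    rw [this, Nat.add_div_right _ hd]
    omega

theorem disjoint_leftShiftIndex_of_rowColor_eq {k n : ℕ} (hk : k ≤ n) (j j' : Fin n)
    {i i' : Fin k} (hne : i ≠ i') (hc : rowColor n j j' i = rowColor n j j' i') :
    Disjoint ({leftShiftIndex hk i j, leftShiftIndex hk i j'} : Set (Fin n))
      {leftShiftIndex hk i' j, leftShiftIndex hk i' j'} := by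
  have hne' : i.val ≠ i'.val := Fin.val_ne_of_ne hne
  simp only [rowColor, Prod.mk.injEq, decide_eq_decide] at hc
  obtain ⟨h1, h2, h3, h4⟩ := hc
  have hA : i.val + j.val ≠ i'.val + j'.val := fun h => add_div_dist_parity hne' h h1
  have hB : i'.val + j.val ≠ i.val + j'.val := fun h => add_div_dist_parity hne'.symm h h1.symm
  simp only [Set.disjoint_insert_left, Set.disjoint_singleton_left, Set.mem_insert_iff,
    Set.mem_singleton_iff, leftShiftIndex_eq_iff]
  omega

theorem card_rows_sharing_le {k n m : ℕ} (hk : k ≤ n) (T : Finset (Fin n))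
    (hT : T.card = 3 * m) (i : Fin k) :
    (Finset.univ.filter (fun i' : Fin k => i' ≠ i ∧
      ∃ j ∈ T, ∃ j' ∈ T,
        min (i.val + j.val + 1) (2 * n - (i.val + j.val + 1))
          = min (i'.val + j'.val + 1) (2 * n - (i'.val + j'.val + 1)))).card
      ≤ 3 * m * (6 * m - 1) := by
  let S (j j' : Fin n) : Finset ℕ :=
    if j = j' then {2 * n - 2 - i - 2 * j} else {i.val + j.val - j'.val, 2 * n - 2 - i - j - j'}
  have hS (j j' : Fin n) : (S j j').card + (if j = j' then 1 else 0) ≤ 2 := by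
    by_cases h : j = j'
    · simp [S, h]
    · simpa [S, h] using Finset.card_le_two
  have hrow (j : Fin n) (hj : j ∈ T) : (T.biUnion (S j)).card ≤ 6 * m - 1 := by
    have h1 : ∑ j' ∈ T, ((S j j').card + (if j = j' then 1 else 0)) ≤ ∑ _j' ∈ T, 2 :=
      Finset.sum_le_sum fun j' _ => hS j j'
    have h2 : (T.biUnion (S j)).card ≤ ∑ j' ∈ T, (S j j').card := Finset.card_biUnion_le
    rw [Finset.sum_add_distrib, Finset.sum_ite_eq, if_pos hj, Finset.sum_const, hT,
      smul_eq_mul] at h1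
    omega
  rw [← Finset.card_image_of_injective _ Fin.val_injective, ← hT]
  refine (Finset.card_le_card (t := T.biUnion fun j => T.biUnion (S j)) ?_).trans
    (Finset.card_biUnion_le_card_mul _ _ _ hrow)
  intro x hx
  obtain ⟨i', hi', rfl⟩ := Finset.mem_image.1 hx
  obtain ⟨hne, j, hj, j', hj', h⟩ := (Finset.mem_filter.1 hi').2
  have hne' : i'.val ≠ i.val := Fin.val_ne_of_ne hne
  refine Finset.mem_biUnion.2 ⟨j, hj, Finset.mem_biUnion.2 ⟨j', hj', ?_⟩⟩
  by_cases hjj : j = j'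
  · subst hjj
    simp only [S, if_true, Finset.mem_singleton]
    omega
  · simp only [S, hjj, if_false, Finset.mem_insert, Finset.mem_singleton]
    omega

/-- Entrywise control of `AᵀA - 1` yields the restricted isometry property. -/
theorem abs_sum_sq_sub_sum_sq_le_of_gram {ι κ : Type*} [Fintype ι] [Fintype κ] [DecidableEq κ]
    {A : Matrix ι κ ℝ} {η : ℝ}
    (hA : ∀ j j', |∑ i, A i j * A i j' - if j = j' then 1 else 0| ≤ η)
    {T : Finset κ} {x : κ → ℝ} (hx : ∀ j, j ∉ T → x j = 0) :
    |∑ i, (∑ j, A i j * x j) ^ 2 - ∑ j, x j ^ 2| ≤ η * T.card * ∑ j, x j ^ 2 := by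
  have hη (h : Nonempty κ) : 0 ≤ η := (abs_nonneg _).trans (hA h.some h.some)
  have hexpand : ∑ i, (∑ j, A i j * x j) ^ 2 - ∑ j, x j ^ 2 =
      ∑ j, ∑ j', (∑ i, A i j * A i j' - if j = j' then 1 else 0) * (x j * x j') := by
    simp only [sub_mul, Finset.sum_sub_distrib, ite_mul, one_mul, zero_mul, Finset.sum_ite_eq,
      Finset.mem_univ, if_true, ← sq]
    congr 1
    simp only [sq, Fintype.sum_mul_sum]
    simp only [Finset.sum_mul]
    rw [Finset.sum_comm]
    refine Finset.sum_congr rfl fun j _ => ?_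
    rw [Finset.sum_comm]
    exact Finset.sum_congr rfl fun j' _ => Finset.sum_congr rfl fun i _ => by ring
  have hsupp (f : κ → ℝ) (hf : ∀ j, x j = 0 → f j = 0) : ∑ j, f j = ∑ j ∈ T, f j :=
    (Finset.sum_subset (Finset.subset_univ T) fun j _ hj => hf j (hx j hj)).symm
  calc |∑ i, (∑ j, A i j * x j) ^ 2 - ∑ j, x j ^ 2|
      ≤ ∑ j, ∑ j', η * (|x j| * |x j'|) := by
        rw [hexpand]
        refine (Finset.abs_sum_le_sum_abs _ _).trans (Finset.sum_le_sum fun j _ => ?_)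
        refine (Finset.abs_sum_le_sum_abs _ _).trans (Finset.sum_le_sum fun j' _ => ?_)
        rw [abs_mul, abs_mul]
        exact mul_le_mul_of_nonneg_right (hA j j') (by positivity)
    _ = η * (∑ j ∈ T, |x j|) ^ 2 := by
        rw [← hsupp (fun j => |x j|) (by simp), sq, Finset.sum_mul_sum]
        simp only [Finset.mul_sum]
    _ ≤ η * (T.card * ∑ j ∈ T, |x j| ^ 2) := by
        rcases isEmpty_or_nonempty κ with h | h
        · simp [Finset.eq_empty_of_isEmpty T]
        · exact mul_le_mul_of_nonneg_left sq_sum_le_card_mul_sum_sq (hη h)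
    _ = η * T.card * ∑ j, x j ^ 2 := by
        rw [hsupp (fun j => x j ^ 2) (by simp), mul_assoc]
        simp only [sq_abs]

theorem card_leftShiftIndex_eq_le_one {k n : ℕ} (hk : k ≤ n) {j j' : Fin n} (h : j ≠ j') :
    (Finset.univ.filter fun i : Fin k => leftShiftIndex hk i j = leftShiftIndex hk i j').card
      ≤ 1 := by
  have h' : j.val ≠ j'.val := Fin.val_ne_of_ne h
  refine Finset.card_le_one.2 fun a ha b hb => Fin.ext ?_
  simp only [Finset.mem_filter, leftShiftIndex_eq_iff] at ha hb
  omega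

theorem abs_gram_leftShiftToeplitz_sub_one_le {k n : ℕ} (hk : k ≤ n) (hk0 : 1 ≤ k) {η : ℝ}
    {a : Fin n → ℝ} (j j' : Fin n) (hη : 1 ≤ η * k)
    (ha : |∑ i : Fin k, centeredProd (k : NNReal)⁻¹ (leftShiftIndex hk i j)
      (leftShiftIndex hk i j') a| ≤ η * k) :
    |∑ i, leftShiftToeplitz k n hk a i j * leftShiftToeplitz k n hk a i j' -
      if j = j' then 1 else 0| ≤ 2 * η := by
  have hk' : (0 : ℝ) < k := by exact_mod_cast hk0
  set G := ∑ i, leftShiftToeplitz k n hk a i j * leftShiftToeplitz k n hk a i j' with hG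
  set D : ℝ := ((Finset.univ.filter fun i : Fin k =>
    leftShiftIndex hk i j = leftShiftIndex hk i j').card : ℝ) with hD
  have hsum : ∑ i : Fin k, centeredProd (k : NNReal)⁻¹ (leftShiftIndex hk i j)
      (leftShiftIndex hk i j') a = k * G - D := by
    simp only [centeredProd, Finset.sum_sub_distrib, Finset.sum_boole, hG, Finset.mul_sum]
    congr 1
    refine Finset.sum_congr rfl fun i _ => ?_
    simp only [NNReal.coe_inv, NNReal.coe_natCast, div_inv_eq_mul]
    exact mul_comm _ _
  rw [hsum] at ha
  have hDk : |D - k * (if j = j' then 1 else 0)| ≤ 1 := by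
    split_ifs with h
    · subst h
      simp [hD]
    · have := card_leftShiftIndex_eq_le_one hk h
      rw [mul_zero, sub_zero, hD, Nat.abs_cast]
      exact_mod_cast this
  refine le_of_mul_le_mul_left ?_ hk'
  calc (k : ℝ) * |G - if j = j' then 1 else 0|
      = |(k * G - D) + (D - k * (if j = j' then 1 else 0))| := by
        rw [← abs_of_pos hk', ← abs_mul, abs_of_pos hk']; ring_nf
    _ ≤ η * k + 1 := (abs_add_le _ _).trans (add_le_add ha hDk)
    _ ≤ k * (2 * η) := by linarith

theorem measureReal_exists_sum_centeredProd_gt_le {k n : ℕ} (hk : k ≤ n) (hk0 : 1 ≤ k) {ε : ℝ}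
    (hε0 : 0 ≤ ε) (hε1 : ε ≤ 1) :
    (Measure.pi fun _ : Fin n => gaussianReal 0 (k : NNReal)⁻¹).real
        {a | ∃ j j' : Fin n, 16 * (ε * k) < |∑ i : Fin k, centeredProd (k : NNReal)⁻¹
          (leftShiftIndex hk i j) (leftShiftIndex hk i j') a|} ≤
      32 * (n : ℝ) ^ 2 * Real.exp (-(ε ^ 2 * k / 8192)) := by
  have hv : (k : NNReal)⁻¹ ≠ 0 := inv_ne_zero (by exact_mod_cast Nat.one_le_iff_ne_zero.1 hk0)
  simp only [Set.ofPred_exists]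
  refine (measureReal_iUnion_fintype_le _).trans ?_
  calc _ ≤ ∑ _j : Fin n, ∑ _j' : Fin n, 16 * (2 * Real.exp (-(ε ^ 2 * k / 8192))) := by
        refine Finset.sum_le_sum fun j _ => (measureReal_iUnion_fintype_le _).trans ?_
        refine Finset.sum_le_sum fun j' _ => ?_
        have h := measureReal_sum_centeredProd_gt_le_of_coloring hv
          (fun i : Fin k => rowColor n j j' i)
          (fun i i' hne hc => disjoint_leftShiftIndex_of_rowColor_eq hk j j' hne hc) hε0 hε1
        simpa using h
    _ = _ := by
        simp only [Finset.sum_const, Finset.card_univ, Fintype.card_fin, nsmul_eq_mul]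
        ring

theorem one_le_log_div {n m : ℕ} (hm : 1 ≤ m) (hn : 3 * m ≤ n) :
    1 ≤ Real.log ((n : ℝ) / m) := by
  have hm' : (1 : ℝ) ≤ m := by exact_mod_cast hm
  have hn' : 3 * (m : ℝ) ≤ n := by exact_mod_cast hn
  have hn0 : (0 : ℝ) < n := by linarith
  rw [Real.le_log_iff_exp_le (by positivity), le_div_iff₀ (by positivity)]
  nlinarith [Real.exp_one_lt_d9]

theorem sq_mul_exp_neg_le_exp_neg {x L κ : ℝ} {n m : ℕ} (hm : 1 ≤ m) (hn : 3 * m ≤ n)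
    (hL : L = Real.log ((n : ℝ) / m)) (hx : 36 * (m * L) ≤ κ * x / 2) :
    32 * (n : ℝ) ^ 2 * Real.exp (-(κ * x)) ≤ Real.exp (-(κ / 2) * x) := by
  have hm' : (1 : ℝ) ≤ m := by exact_mod_cast hm
  have hn' : 3 * (m : ℝ) ≤ n := by exact_mod_cast hn
  have hn0 : (0 : ℝ) < n := by linarith
  have hL1 : 1 ≤ L := hL ▸ one_le_log_div hm hn
  have hlogn : Real.log n = L + Real.log m := by
    rw [hL, Real.log_div hn0.ne' (by positivity)]; ring
  have hlogm : Real.log m ≤ m := Real.log_le_self (by positivity)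
  have hmL : (m : ℝ) ≤ m * L := le_mul_of_one_le_right (by positivity) hL1
  have hLm : L ≤ m * L := le_mul_of_one_le_left (by linarith) hm'
  have hlog32 : Real.log 32 ≤ 32 := Real.log_le_self (by norm_num)
  have h32 : 32 * (n : ℝ) ^ 2 = Real.exp (Real.log 32 + 2 * Real.log n) := by
    rw [Real.exp_add, Real.exp_log (by norm_num), two_mul, Real.exp_add, Real.exp_log hn0, sq]
  rw [h32, ← Real.exp_add]
  refine Real.exp_le_exp.2 ?_
  linarith

/-- Corollary 2.3: for the left-shifted symmetric Toeplitz-type matrix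
with i.i.d. `N(0,1/k)` entries: (i) each row of any `3m`-column submatrix `A_T` shares
generating variables with at most `3m(6m-1)` other rows, and (ii) there are constants
`c₁, c₂ > 0` depending only on `δ ∈ (0,1/3)` such that `A` satisfies RIP of order `3m`
with constant `δ` with probability at least `1 - e^{-c₂ k/m²}` whenever
`k ≥ c₁ m³ ln(n/m)`. -/
theorem stmt_12 (δ : ℝ) (hδ0 : 0 < δ) (hδ1 : δ < 1 / 3) :
    ∃ c₁ c₂ : ℝ, 0 < c₁ ∧ 0 < c₂ ∧
      ∀ k n m : ℕ, 1 ≤ k → 1 ≤ m → 3 * m ≤ n → ∀ hk : k ≤ n,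
        ((∀ T : Finset (Fin n), T.card = 3 * m → ∀ i : Fin k,
          (Finset.univ.filter (fun i' : Fin k => i' ≠ i ∧
              ∃ j ∈ T, ∃ j' ∈ T,
                min (i.val + j.val + 1) (2 * n - (i.val + j.val + 1))
                  = min (i'.val + j'.val + 1) (2 * n - (i'.val + j'.val + 1)))).card
            ≤ 3 * m * (6 * m - 1)) ∧
        (c₁ * m ^ 3 * Real.log ((n : ℝ) / m) ≤ k →
          ENNReal.ofReal (1 - Real.exp (-c₂ * k / m ^ 2)) ≤
            (Measure.pi fun _ : Fin n => gaussianReal 0 ((k : NNReal))⁻¹)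
              {a | ∀ T : Finset (Fin n), T.card ≤ 3 * m →
                ∀ x : Fin n → ℝ, (∀ j, j ∉ T → x j = 0) →
                  (1 - δ) * ∑ j, x j ^ 2
                      ≤ ∑ i, (∑ j, leftShiftToeplitz k n hk a i j * x j) ^ 2 ∧
                  ∑ i, (∑ j, leftShiftToeplitz k n hk a i j * x j) ^ 2
                      ≤ (1 + δ) * ∑ j, x j ^ 2})) := by
  have hκ : 0 < δ ^ 2 / (9216 * 8192) := by positivity
  set κ := δ ^ 2 / (9216 * 8192) with hκdef
  refine ⟨72 / κ + 6 / δ, κ / 2, by positivity, by positivity, ?_⟩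
  intro k n m hk0 hm hmn hk
  refine ⟨fun T hT i => card_rows_sharing_le hk T hT i, fun hkm => ?_⟩
  have hm' : (1 : ℝ) ≤ m := by exact_mod_cast hm
  have hk' : (0 : ℝ) < k := by exact_mod_cast hk0
  obtain ⟨L, hL⟩ : ∃ L, L = Real.log ((n : ℝ) / m) := ⟨_, rfl⟩
  rw [← hL] at hkm
  have hL1 : 1 ≤ L := hL ▸ one_le_log_div hm hmn
  have hL0 : 0 ≤ L := by linarith
  have hkm₁ : 72 / κ * (m ^ 3 * L) ≤ k := by
    have : 0 ≤ 6 / δ * (m ^ 3 * L) := by positivity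
    linarith
  have hkm₂ : 6 / δ * m ≤ k := by
    have h1 : 0 ≤ 72 / κ * (m ^ 3 * L) := by positivity
    have h2 : (m : ℝ) ≤ m ^ 3 * L :=
      (le_self_pow₀ hm' (by norm_num)).trans (le_mul_of_one_le_right (by positivity) hL1)
    have h3 : 6 / δ * m ≤ 6 / δ * (m ^ 3 * L) := by gcongr
    linarith
  have hη : 1 ≤ δ / (6 * m) * k := by
    calc (1 : ℝ) = δ / (6 * m) * (6 / δ * m) := by field_simp
      _ ≤ _ := by gcongr
  have hε1 : δ / (96 * m) ≤ 1 := by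
    rw [div_le_one (by positivity)]; linarith
  set μ := Measure.pi fun _ : Fin n => gaussianReal 0 (k : NNReal)⁻¹
  set S := {a : Fin n → ℝ | ∃ j j' : Fin n, 16 * (δ / (96 * m) * k) <
    |∑ i : Fin k, centeredProd (k : NNReal)⁻¹ (leftShiftIndex hk i j) (leftShiftIndex hk i j') a|}
    with hS
  have hSmeas : MeasurableSet S := by
    simp only [hS, Set.ofPred_exists]
    refine .iUnion fun j => .iUnion fun j' => measurableSet_lt measurable_const ?_
    exact (Finset.measurable_fun_sum _ fun i _ => measurable_centeredProd _ _).abs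
  have hSle : μ.real S ≤ Real.exp (-(κ / 2) * k / m ^ 2) := by
    refine (measureReal_exists_sum_centeredProd_gt_le hk hk0 (by positivity) hε1).trans ?_
    have h : 36 * (m * L) ≤ κ * (k / m ^ 2) / 2 := by
      calc 36 * (m * L) = κ * (72 / κ * (m ^ 3 * L) / m ^ 2) / 2 := by field_simp; norm_num
        _ ≤ _ := by gcongr
    have e₁ : (δ / (96 * m)) ^ 2 * k / 8192 = κ * (k / m ^ 2) := by
      rw [hκdef]; field_simp; norm_num
    rw [e₁, mul_div_assoc]
    exact sq_mul_exp_neg_le_exp_neg hm hmn hL h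
  calc ENNReal.ofReal (1 - Real.exp (-(κ / 2) * k / m ^ 2))
      ≤ ENNReal.ofReal (μ.real Sᶜ) := by
        rw [probReal_compl_eq_one_sub hSmeas]; gcongr
    _ = μ Sᶜ := ofReal_measureReal
    _ ≤ _ := measure_mono ?_
  intro a ha T hT x hx
  simp only [hS, Set.mem_compl_iff, Set.mem_ofPred_eq, not_exists, not_lt] at ha
  have hgram (j j' : Fin n) := abs_gram_leftShiftToeplitz_sub_one_le hk hk0 (a := a) j j' hη
    ((ha j j').trans_eq (by field_simp; norm_num))
  have hrip := abs_sum_sq_sub_sum_sq_le_of_gram hgram hx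
  have hcard : 2 * (δ / (6 * m)) * T.card ≤ δ := by
    have hT' : (T.card : ℝ) ≤ 3 * m := by exact_mod_cast hT
    calc 2 * (δ / (6 * m)) * T.card ≤ 2 * (δ / (6 * m)) * (3 * m) := by gcongr
      _ = δ := by field_simp; norm_num
  have hrip' := abs_le.1 (hrip.trans (mul_le_mul_of_nonneg_right hcard
    (Finset.sum_nonneg fun j _ => sq_nonneg (x j))))
  constructor <;> linarith [hrip'.1, hrip'.2]
end
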